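/- Each of the ten atomic-flow reduction rules w↓-c↓, c↑-w↑, w↓-i↑, i↓-w↑, w↓-w↑, w↓-c↑, c↓-w↑, c↓-i↑, i↓-c↑ and c↓-c↑ is sound: whenever a flow A reduces to a flow B by one of these rules and Φ is an SKS derivation whose associated atomic flow is A, there exists an SKS derivation Ψ whose associated atomic flow is B and whose premiss and conclusion are the same as those of Φ. -/

import Mathlib

set_option linter.unusedVariables false

namespace AF

/-! ### Formulae of system SKS.

Atoms are pairs `(n, b)`; the involution `ā` flips the Boolean, so it is
fixed-point free. -/

inductive Formula : Type
  | tt : Formula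
  | ff : Formula
  | atom : ℕ → Bool → Formula
  | or : Formula → Formula → Formula
  | and : Formula → Formula → Formula
  deriving DecidableEq

namespace Formula

/-- Subformula at a position (`false` = left child, `true` = right child). -/
def sub : Formula → List Bool → Option Formula
  | φ, [] => some φ
  | .or α _, false :: p => sub α p
  | .or _ β, true :: p => sub β p
  | .and α _, false :: p => sub α p
  | .and _ β, true :: p => sub β p
  | _, _ :: _ => none

/-- Replace the subformula at a position. -/
def repl : Formula → List Bool → Formula → Formula
  | _, [], ψ => ψ
  | .or α β, false :: p, ψ => .or (repl α p ψ) β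
  | .or α β, true :: p, ψ => .or α (repl β p ψ)
  | .and α β, false :: p, ψ => .and (repl α p ψ) β
  | .and α β, true :: p, ψ => .and α (repl β p ψ)
  | φ, _ :: _, _ => φ

/-- `p` is an atom occurrence of `φ`. -/
def IsOcc (φ : Formula) (p : List Bool) : Prop :=
  ∃ n b, φ.sub p = some (.atom n b)

end Formula

/-! ### Inference rules.

The rule `=` of SKS replaces a formula by an equivalent one under
commutativity, associativity and the unit equations; each single instance of
`=` applies one equation (in either direction), so we list the equations as
individual rule names, all marked as being instances of `=` via `isEq`. -/

inductive RuleName : Type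
  | aiDown | aiUp | awDown | awUp | acDown | acUp
  | s | m
  | eqOrComm | eqAndComm
  | eqOrAssocL | eqOrAssocR | eqAndAssocL | eqAndAssocR
  | eqOrUnitDel | eqOrUnitAdd | eqAndUnitDel | eqAndUnitAdd
  | eqTTDel | eqTTAdd | eqFFDel | eqFFAdd
  deriving DecidableEq

namespace RuleName

/-- The atomic structural rules. -/
def isStructural : RuleName → Bool
  | .aiDown | .aiUp | .awDown | .awUp | .acDown | .acUp => true
  | _ => false

/-- The rule names that are instances of the rule `=`. -/
def isEq : RuleName → Bool
  | .aiDown | .aiUp | .awDown | .awUp | .acDown | .acUp | .s | .m => false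
  | _ => true

end RuleName

/-- Rule instances (redex ⟹ contractum). -/
inductive RuleInstance : RuleName → Formula → Formula → Prop
  | aiDown (n : ℕ) (b : Bool) :
      RuleInstance .aiDown .tt (.or (.atom n b) (.atom n (!b)))
  | aiUp (n : ℕ) (b : Bool) :
      RuleInstance .aiUp (.and (.atom n b) (.atom n (!b))) .ff
  | awDown (n : ℕ) (b : Bool) : RuleInstance .awDown .ff (.atom n b)
  | awUp (n : ℕ) (b : Bool) : RuleInstance .awUp (.atom n b) .tt
  | acDown (n : ℕ) (b : Bool) :
      RuleInstance .acDown (.or (.atom n b) (.atom n b)) (.atom n b)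
  | acUp (n : ℕ) (b : Bool) :
      RuleInstance .acUp (.atom n b) (.and (.atom n b) (.atom n b))
  | s (α β γ : Formula) :
      RuleInstance .s (.and α (.or β γ)) (.or (.and α β) γ)
  | m (α β γ δ : Formula) :
      RuleInstance .m (.or (.and α β) (.and γ δ)) (.and (.or α γ) (.or β δ))
  | eqOrComm (α β : Formula) : RuleInstance .eqOrComm (.or α β) (.or β α)
  | eqAndComm (α β : Formula) : RuleInstance .eqAndComm (.and α β) (.and β α)
  | eqOrAssocL (α β γ : Formula) :
      RuleInstance .eqOrAssocL (.or (.or α β) γ) (.or α (.or β γ))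
  | eqOrAssocR (α β γ : Formula) :
      RuleInstance .eqOrAssocR (.or α (.or β γ)) (.or (.or α β) γ)
  | eqAndAssocL (α β γ : Formula) :
      RuleInstance .eqAndAssocL (.and (.and α β) γ) (.and α (.and β γ))
  | eqAndAssocR (α β γ : Formula) :
      RuleInstance .eqAndAssocR (.and α (.and β γ)) (.and (.and α β) γ)
  | eqOrUnitDel (α : Formula) : RuleInstance .eqOrUnitDel (.or α .ff) α
  | eqOrUnitAdd (α : Formula) : RuleInstance .eqOrUnitAdd α (.or α .ff)
  | eqAndUnitDel (α : Formula) : RuleInstance .eqAndUnitDel (.and α .tt) α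
  | eqAndUnitAdd (α : Formula) : RuleInstance .eqAndUnitAdd α (.and α .tt)
  | eqTTDel : RuleInstance .eqTTDel (.or .tt .tt) .tt
  | eqTTAdd : RuleInstance .eqTTAdd .tt (.or .tt .tt)
  | eqFFDel : RuleInstance .eqFFDel (.and .ff .ff) .ff
  | eqFFAdd : RuleInstance .eqFFAdd .ff (.and .ff .ff)

/-- One (deep) inference step applying rule `r` at position `q`. -/
def StepAt (r : RuleName) (q : List Bool) (φ ψ : Formula) : Prop :=
  ∃ γ δ, φ.sub q = some γ ∧ RuleInstance r γ δ ∧ ψ = φ.repl q δ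

/-- One inference step using a rule from the set `S`. -/
def Step (S : Set RuleName) (φ ψ : Formula) : Prop :=
  ∃ r ∈ S, ∃ q, StepAt r q φ ψ

/-- There is a derivation from `φ` to `ψ` using only rules from `S`. -/
def Derives (S : Set RuleName) : Formula → Formula → Prop :=
  Relation.ReflTransGen (Step S)

/-! ### Derivations as explicit data (for the theory of atomic flows). -/

/-- A derivation: a premiss and a chain of steps, each recorded by its rule
name, the position of the redex, and the resulting formula. -/
structure Deriv : Type where
  prem : Formula
  steps : List (RuleName × List Bool × Formula)

namespace Deriv

/-- The `i`-th step datum. -/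
def stepAt (Φ : Deriv) (i : ℕ) : RuleName × List Bool × Formula :=
  Φ.steps.getD i (RuleName.s, ([] : List Bool), Formula.tt)

/-- The `i`-th formula of the derivation (`0` is the premiss). -/
def fml (Φ : Deriv) (i : ℕ) : Formula :=
  (Φ.prem :: Φ.steps.map (fun t => t.2.2)).getD i Φ.prem

/-- Number of formulae in the derivation. -/
def nf (Φ : Deriv) : ℕ := Φ.steps.length + 1

/-- The conclusion of the derivation. -/
def concl (Φ : Deriv) : Formula := Φ.fml Φ.steps.length

/-- The derivation is well formed: every recorded step is a correct
inference step of SKS. -/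
def WF (Φ : Deriv) : Prop :=
  ∀ i, i < Φ.steps.length →
    StepAt (Φ.stepAt i).1 (Φ.stepAt i).2.1 (Φ.fml i) (Φ.fml (i + 1))

end Deriv

/-! ### Atomic flows. -/

inductive FlowLabel : Type
  | aiDown | aiUp | awDown | awUp | acDown | acUp
  deriving DecidableEq

/-- Required (number of lower edges, number of upper edges) of a vertex. -/
def labDeg : FlowLabel → ℕ × ℕ
  | .aiDown => (2, 0)
  | .aiUp => (0, 2)
  | .awDown => (1, 0)
  | .awUp => (0, 1)
  | .acDown => (1, 2)
  | .acUp => (2, 1)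

/-- The data of an atomic flow: vertices, edges, labels, and the two
endpoint maps.  `up e = none` means the upper endpoint is `⊤`, and
`lo e = none` means the lower endpoint is `⊥`. -/
structure PreFlow : Type where
  V : Finset ℕ
  E : Finset ℕ
  η : ℕ → FlowLabel
  up : ℕ → Option ℕ
  lo : ℕ → Option ℕ

namespace PreFlow

/-- Lower edges of a vertex. -/
def Ledges (F : PreFlow) (v : ℕ) : Finset ℕ :=
  F.E.filter (fun e => F.up e = some v)

/-- Upper edges of a vertex. -/
def Uedges (F : PreFlow) (v : ℕ) : Finset ℕ :=
  F.E.filter (fun e => F.lo e = some v)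

/-- All edges of a vertex. -/
def edges (F : PreFlow) (v : ℕ) : Finset ℕ := F.Ledges v ∪ F.Uedges v

def degOK (F : PreFlow) : Prop :=
  ∀ v ∈ F.V, (F.Ledges v).card = (labDeg (F.η v)).1 ∧
    (F.Uedges v).card = (labDeg (F.η v)).2

def endpointsOK (F : PreFlow) : Prop :=
  ∀ e ∈ F.E, (∀ v, F.up e = some v → v ∈ F.V) ∧
    (∀ v, F.lo e = some v → v ∈ F.V)

/-- No cyclic sequence of edges `ε₁, …, ε_h` with
`up (ε_i) = lo (ε_(i+1 mod h))`. -/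
def Acyclic (F : PreFlow) : Prop :=
  ¬ ∃ (h : ℕ) (ε : Fin (h + 1) → ℕ), (∀ i, ε i ∈ F.E) ∧
      ∀ i : Fin (h + 1), (F.up (ε i)).isSome ∧ F.up (ε i) = F.lo (ε (i + 1))

/-- `π` is a polarity assignment (`false` = `−`, `true` = `+`). -/
def PolarityOK (F : PreFlow) (π : ℕ → Bool) : Prop :=
  ∀ v ∈ F.V,
    ((F.η v = .acDown ∨ F.η v = .acUp) →
      ∀ e₁ ∈ F.edges v, ∀ e₂ ∈ F.edges v, π e₁ = π e₂) ∧
    ((F.η v = .aiDown ∨ F.η v = .aiUp) →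
      ∃ e₁ ∈ F.edges v, ∃ e₂ ∈ F.edges v, π e₁ ≠ π e₂)

/-- `F` is an atomic flow. -/
def IsFlow (F : PreFlow) : Prop :=
  F.degOK ∧ F.endpointsOK ∧ F.Acyclic ∧ ∃ π, F.PolarityOK π

end PreFlow

/-! ### Paths, ai-paths, cycles. -/

/-- An endpoint of a path: a vertex, or `⊤`, or `⊥`. -/
inductive VPt : Type
  | ver : ℕ → VPt
  | top : VPt
  | bot : VPt
  deriving DecidableEq

/-- The upper endpoint of edge `e` is `ν`. -/
def srcOK (F : PreFlow) (ν : VPt) (e : ℕ) : Prop :=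
  match ν with
  | .ver v => F.up e = some v
  | .top => F.up e = none
  | .bot => False

/-- The lower endpoint of edge `e` is `ν`. -/
def tgtOK (F : PreFlow) (ν : VPt) (e : ℕ) : Prop :=
  match ν with
  | .ver v => F.lo e = some v
  | .bot => F.lo e = none
  | .top => False

/-- A downward path from `ν` to `ν'` (a nonempty sequence of edges, each
hanging from the lower endpoint of the previous one). -/
def IsDownPath (F : PreFlow) (ν ν' : VPt) (l : List ℕ) : Prop :=
  l ≠ [] ∧ (∀ e ∈ l, e ∈ F.E) ∧
  (∀ i, i + 1 < l.length →
    ∃ v ∈ F.V, F.lo (l.getD i 0) = some v ∧ F.up (l.getD (i + 1) 0) = some v) ∧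
  srcOK F ν (l.getD 0 0) ∧ tgtOK F ν' (l.getD (l.length - 1) 0)

/-- A path from `ν` to `ν'`: a downward path, or the reverse of a
downward path from `ν'` to `ν`. -/
def IsPath (F : PreFlow) (ν ν' : VPt) (l : List ℕ) : Prop :=
  IsDownPath F ν ν' l ∨ IsDownPath F ν' ν l.reverse

/-- ai-paths: paths, closed under concatenation (in distinct edges) at
interaction and cointeraction vertices. -/
inductive AIPath (F : PreFlow) : VPt → VPt → List ℕ → Prop
  | single {ν ν' : VPt} {l : List ℕ} : IsPath F ν ν' l → AIPath F ν ν' l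
  | join {ν ν' : VPt} {v : ℕ} {l₁ l₂ : List ℕ} {e e' : ℕ} :
      v ∈ F.V → (F.η v = .aiDown ∨ F.η v = .aiUp) →
      AIPath F ν (.ver v) (l₁ ++ [e]) →
      AIPath F (.ver v) ν' (e' :: l₂) →
      e ≠ e' →
      AIPath F ν ν' (l₁ ++ [e] ++ e' :: l₂)

/-- The flow contains an ai-cycle: an ai-path from a vertex to itself in
which no edge appears twice. -/
def HasAICycle (F : PreFlow) : Prop :=
  ∃ v l, v ∈ F.V ∧ AIPath F (.ver v) (.ver v) l ∧ l.Nodup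

def CycleFree (F : PreFlow) : Prop := ¬ HasAICycle F

/-- An ai-connection: a path from an interaction vertex to a cointeraction
vertex or vice versa. -/
def IsConnection (F : PreFlow) (l : List ℕ) : Prop :=
  ∃ v v', v ∈ F.V ∧ v' ∈ F.V ∧
    ((F.η v = .aiDown ∧ F.η v' = .aiUp) ∨
     (F.η v = .aiUp ∧ F.η v' = .aiDown)) ∧
    IsPath F (.ver v) (.ver v') l

/-- A simple edge: an ai-connection consisting of a single edge. -/
def SimpleEdge (F : PreFlow) (e : ℕ) : Prop := IsConnection F [e]

/-- A clean path: an ai-path all of whose ai-connections are simple edges. -/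
def IsCleanPath (F : PreFlow) (ν ν' : VPt) (l : List ℕ) : Prop :=
  AIPath F ν ν' l ∧
  ∀ l₁ l₂ l₃, l = l₁ ++ l₂ ++ l₃ → IsConnection F l₂ → l₂.length = 1

/-! ### Local flow reduction rules. -/

open PreFlow

/-- Rule `w↓-c↓`: a weakening feeding a contraction is erased, merging the
contraction's other two edges. -/
def RedWdCd (A B : PreFlow) : Prop :=
  ∃ v₁ v₂ e e₂ e₃,
    v₁ ∈ A.V ∧ v₂ ∈ A.V ∧ v₁ ≠ v₂ ∧
    A.η v₁ = .awDown ∧ A.η v₂ = .acDown ∧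
    e ∈ A.E ∧ e₂ ∈ A.E ∧ e₃ ∈ A.E ∧ e ≠ e₂ ∧ e ≠ e₃ ∧ e₂ ≠ e₃ ∧
    A.up e = some v₁ ∧ A.lo e = some v₂ ∧
    A.lo e₂ = some v₂ ∧ A.up e₃ = some v₂ ∧
    B.V = (A.V.erase v₁).erase v₂ ∧
    B.E = (A.E.erase e).erase e₃ ∧
    B.η = A.η ∧ B.up = A.up ∧
    B.lo = Function.update A.lo e₂ (A.lo e₃)

/-- Rule `c↑-w↑` (dual of `w↓-c↓`). -/
def RedCuWu (A B : PreFlow) : Prop :=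
  ∃ v₁ v₂ e e₂ e₃,
    v₁ ∈ A.V ∧ v₂ ∈ A.V ∧ v₁ ≠ v₂ ∧
    A.η v₁ = .awUp ∧ A.η v₂ = .acUp ∧
    e ∈ A.E ∧ e₂ ∈ A.E ∧ e₃ ∈ A.E ∧ e ≠ e₂ ∧ e ≠ e₃ ∧ e₂ ≠ e₃ ∧
    A.lo e = some v₁ ∧ A.up e = some v₂ ∧
    A.up e₂ = some v₂ ∧ A.lo e₃ = some v₂ ∧
    B.V = (A.V.erase v₁).erase v₂ ∧
    B.E = (A.E.erase e).erase e₃ ∧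
    B.η = A.η ∧ B.lo = A.lo ∧
    B.up = Function.update A.up e₂ (A.up e₃)

/-- Rule `w↓-i↑`: a weakening feeding a cointeraction is replaced by a
coweakening on the other cointeraction edge. -/
def RedWdIu (A B : PreFlow) : Prop :=
  ∃ v₁ v₂ e e₂,
    v₁ ∈ A.V ∧ v₂ ∈ A.V ∧ v₁ ≠ v₂ ∧
    A.η v₁ = .awDown ∧ A.η v₂ = .aiUp ∧
    e ∈ A.E ∧ e₂ ∈ A.E ∧ e ≠ e₂ ∧
    A.up e = some v₁ ∧ A.lo e = some v₂ ∧ A.lo e₂ = some v₂ ∧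
    B.V = A.V.erase v₁ ∧ B.E = A.E.erase e ∧
    B.η = Function.update A.η v₂ .awUp ∧
    B.up = A.up ∧ B.lo = A.lo

/-- Rule `i↓-w↑` (dual of `w↓-i↑`). -/
def RedIdWu (A B : PreFlow) : Prop :=
  ∃ v₁ v₂ e e₂,
    v₁ ∈ A.V ∧ v₂ ∈ A.V ∧ v₁ ≠ v₂ ∧
    A.η v₁ = .awUp ∧ A.η v₂ = .aiDown ∧
    e ∈ A.E ∧ e₂ ∈ A.E ∧ e ≠ e₂ ∧
    A.lo e = some v₁ ∧ A.up e = some v₂ ∧ A.up e₂ = some v₂ ∧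
    B.V = A.V.erase v₁ ∧ B.E = A.E.erase e ∧
    B.η = Function.update A.η v₂ .awDown ∧
    B.up = A.up ∧ B.lo = A.lo

/-- Rule `w↓-w↑`: a weakening joined to a coweakening is erased. -/
def RedWdWu (A B : PreFlow) : Prop :=
  ∃ v₁ v₂ e,
    v₁ ∈ A.V ∧ v₂ ∈ A.V ∧ v₁ ≠ v₂ ∧
    A.η v₁ = .awDown ∧ A.η v₂ = .awUp ∧
    e ∈ A.E ∧ A.up e = some v₁ ∧ A.lo e = some v₂ ∧
    B.V = (A.V.erase v₁).erase v₂ ∧ B.E = A.E.erase e ∧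
    B.η = A.η ∧ B.up = A.up ∧ B.lo = A.lo

/-- Rule `w↓-c↑`: a weakening feeding a cocontraction is replaced by two
weakenings. -/
def RedWdCu (A B : PreFlow) : Prop :=
  ∃ v₁ v₂ e e₁ e₂,
    v₁ ∈ A.V ∧ v₂ ∈ A.V ∧ v₁ ≠ v₂ ∧
    A.η v₁ = .awDown ∧ A.η v₂ = .acUp ∧
    e ∈ A.E ∧ e₁ ∈ A.E ∧ e₂ ∈ A.E ∧ e ≠ e₁ ∧ e ≠ e₂ ∧ e₁ ≠ e₂ ∧
    A.up e = some v₁ ∧ A.lo e = some v₂ ∧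
    A.up e₁ = some v₂ ∧ A.up e₂ = some v₂ ∧
    B.V = A.V ∧ B.E = A.E.erase e ∧
    B.η = Function.update A.η v₂ .awDown ∧
    B.up = Function.update A.up e₁ (some v₁) ∧
    B.lo = A.lo

/-- Rule `c↓-w↑` (dual of `w↓-c↑`). -/
def RedCdWu (A B : PreFlow) : Prop :=
  ∃ v₁ v₂ e e₁ e₂,
    v₁ ∈ A.V ∧ v₂ ∈ A.V ∧ v₁ ≠ v₂ ∧
    A.η v₁ = .awUp ∧ A.η v₂ = .acDown ∧
    e ∈ A.E ∧ e₁ ∈ A.E ∧ e₂ ∈ A.E ∧ e ≠ e₁ ∧ e ≠ e₂ ∧ e₁ ≠ e₂ ∧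
    A.lo e = some v₁ ∧ A.up e = some v₂ ∧
    A.lo e₁ = some v₂ ∧ A.lo e₂ = some v₂ ∧
    B.V = A.V ∧ B.E = A.E.erase e ∧
    B.η = Function.update A.η v₂ .awUp ∧
    B.lo = Function.update A.lo e₁ (some v₁) ∧
    B.up = A.up

/-- Rule `c↓-i↑`: a contraction whose output edge enters a cointeraction is
replaced by a cocontraction on the other cointeraction edge followed by two
cointeractions. -/
def RedCdIu (A B : PreFlow) : Prop :=
  ∃ v₁ v₂ v₃ e e₁ e₂ e₃ g₁ g₂,
    v₁ ∈ A.V ∧ v₂ ∈ A.V ∧ v₁ ≠ v₂ ∧ v₃ ∉ A.V ∧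
    A.η v₁ = .acDown ∧ A.η v₂ = .aiUp ∧
    e ∈ A.E ∧ e₁ ∈ A.E ∧ e₂ ∈ A.E ∧ e₃ ∈ A.E ∧
    e ≠ e₁ ∧ e ≠ e₂ ∧ e ≠ e₃ ∧ e₁ ≠ e₂ ∧ e₁ ≠ e₃ ∧ e₂ ≠ e₃ ∧
    g₁ ∉ A.E ∧ g₂ ∉ A.E ∧ g₁ ≠ g₂ ∧
    A.lo e₁ = some v₁ ∧ A.lo e₂ = some v₁ ∧
    A.up e = some v₁ ∧ A.lo e = some v₂ ∧ A.lo e₃ = some v₂ ∧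
    B.V = insert v₃ A.V ∧
    B.E = insert g₁ (insert g₂ (A.E.erase e)) ∧
    B.η = Function.update (Function.update A.η v₁ .acUp) v₃ .aiUp ∧
    B.up = Function.update (Function.update A.up g₁ (some v₁)) g₂ (some v₁) ∧
    B.lo = Function.update (Function.update (Function.update
      (Function.update (Function.update A.lo e₁ (some v₂)) e₂ (some v₃))
        e₃ (some v₁)) g₁ (some v₂)) g₂ (some v₃)

/-- Rule `i↓-c↑` (dual of `c↓-i↑`). -/
def RedIdCu (A B : PreFlow) : Prop :=
  ∃ v₁ v₂ v₃ e e₁ e₂ e₃ g₁ g₂,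
    v₁ ∈ A.V ∧ v₂ ∈ A.V ∧ v₁ ≠ v₂ ∧ v₃ ∉ A.V ∧
    A.η v₁ = .acUp ∧ A.η v₂ = .aiDown ∧
    e ∈ A.E ∧ e₁ ∈ A.E ∧ e₂ ∈ A.E ∧ e₃ ∈ A.E ∧
    e ≠ e₁ ∧ e ≠ e₂ ∧ e ≠ e₃ ∧ e₁ ≠ e₂ ∧ e₁ ≠ e₃ ∧ e₂ ≠ e₃ ∧
    g₁ ∉ A.E ∧ g₂ ∉ A.E ∧ g₁ ≠ g₂ ∧
    A.up e₁ = some v₁ ∧ A.up e₂ = some v₁ ∧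
    A.lo e = some v₁ ∧ A.up e = some v₂ ∧ A.up e₃ = some v₂ ∧
    B.V = insert v₃ A.V ∧
    B.E = insert g₁ (insert g₂ (A.E.erase e)) ∧
    B.η = Function.update (Function.update A.η v₁ .acDown) v₃ .aiDown ∧
    B.lo = Function.update (Function.update A.lo g₁ (some v₁)) g₂ (some v₁) ∧
    B.up = Function.update (Function.update (Function.update
      (Function.update (Function.update A.up e₁ (some v₂)) e₂ (some v₃))
        e₃ (some v₁)) g₁ (some v₂)) g₂ (some v₃)

/-- Rule `c↓-c↑`: a contraction whose output enters a cocontraction is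
replaced by two cocontractions above two contractions, crosswise connected. -/
def RedCdCu (A B : PreFlow) : Prop :=
  ∃ v₁ v₂ v₃ v₄ e e₁ e₂ e₃ e₄ g₁₁ g₁₂ g₂₁ g₂₂,
    v₁ ∈ A.V ∧ v₂ ∈ A.V ∧ v₁ ≠ v₂ ∧
    v₃ ∉ A.V ∧ v₄ ∉ A.V ∧ v₃ ≠ v₄ ∧
    A.η v₁ = .acDown ∧ A.η v₂ = .acUp ∧
    e ∈ A.E ∧ e₁ ∈ A.E ∧ e₂ ∈ A.E ∧ e₃ ∈ A.E ∧ e₄ ∈ A.E ∧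
    e ≠ e₁ ∧ e ≠ e₂ ∧ e ≠ e₃ ∧ e ≠ e₄ ∧
    e₁ ≠ e₂ ∧ e₁ ≠ e₃ ∧ e₁ ≠ e₄ ∧ e₂ ≠ e₃ ∧ e₂ ≠ e₄ ∧ e₃ ≠ e₄ ∧
    g₁₁ ∉ A.E ∧ g₁₂ ∉ A.E ∧ g₂₁ ∉ A.E ∧ g₂₂ ∉ A.E ∧
    g₁₁ ≠ g₁₂ ∧ g₁₁ ≠ g₂₁ ∧ g₁₁ ≠ g₂₂ ∧ g₁₂ ≠ g₂₁ ∧ g₁₂ ≠ g₂₂ ∧ g₂₁ ≠ g₂₂ ∧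
    A.lo e₁ = some v₁ ∧ A.lo e₂ = some v₁ ∧ A.up e = some v₁ ∧
    A.lo e = some v₂ ∧ A.up e₃ = some v₂ ∧ A.up e₄ = some v₂ ∧
    B.V = insert v₃ (insert v₄ A.V) ∧
    B.E = insert g₁₁ (insert g₁₂ (insert g₂₁ (insert g₂₂ (A.E.erase e)))) ∧
    B.η = Function.update (Function.update (Function.update
      (Function.update A.η v₁ .acUp) v₂ .acUp) v₃ .acDown) v₄ .acDown ∧
    B.up = Function.update (Function.update (Function.update
      (Function.update (Function.update (Function.update A.up
        e₃ (some v₃)) e₄ (some v₄)) g₁₁ (some v₁)) g₁₂ (some v₁))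
          g₂₁ (some v₂)) g₂₂ (some v₂) ∧
    B.lo = Function.update (Function.update (Function.update
      (Function.update (Function.update A.lo e₂ (some v₂)) g₁₁ (some v₃))
        g₁₂ (some v₄)) g₂₁ (some v₃)) g₂₂ (some v₄)

/-- One step of the flow rewriting system `w`. -/
def StepW (A B : PreFlow) : Prop :=
  RedWdCd A B ∨ RedCuWu A B ∨ RedWdIu A B ∨ RedIdWu A B ∨
  RedWdWu A B ∨ RedWdCu A B ∨ RedCdWu A B

/-- One step of the flow rewriting system `c`. -/
def StepC (A B : PreFlow) : Prop :=
  RedCdIu A B ∨ RedIdCu A B ∨ RedCdCu A B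

/-- `A` is normal for the flow rewriting system `w`. -/
def NormalW (A : PreFlow) : Prop := ¬ ∃ B, StepW A B

/-- `A` is normal for the flow rewriting system `c`. -/
def NormalC (A : PreFlow) : Prop := ¬ ∃ B, StepC A B

/-! ### Flow isomorphisms. -/

structure FlowIso (A B : PreFlow) : Type where
  vmap : ℕ → ℕ
  emap : ℕ → ℕ
  vbij : Set.BijOn vmap (A.V : Set ℕ) (B.V : Set ℕ)
  ebij : Set.BijOn emap (A.E : Set ℕ) (B.E : Set ℕ)
  lab : ∀ v ∈ A.V, B.η (vmap v) = A.η v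
  upc : ∀ e ∈ A.E, B.up (emap e) = (A.up e).map vmap
  loc : ∀ e ∈ A.E, B.lo (emap e) = (A.lo e).map vmap

/-! ### The global reduction `→se` (elimination of a simple edge). -/

/-- The flow obtained from `B` by eliminating the simple edge `e0` between
the interaction `vi` and the cointeraction `vc` (with `e2` the other lower
edge of `vi` and `e3` the other upper edge of `vc`): two copies (tags `0`,
hat, the lower one, and `1`, tilde, the upper one) of the remaining flow are
glued by identifying the hat copy of `e2` with the tilde copy of `e3`; a
weakening (vertex `(2,0)`) is placed above the tilde copy of `e2`, a
coweakening (vertex `(2,1)`) below the hat copy of `e3`; each upper edge `ε`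
of `B` gives a cocontraction (vertex `(3,ε)`, with a new upper edge `(3,ε)`)
joining the two copies of `ε`, and dually each lower edge `ε'` of `B` gives
a contraction (vertex `(4,ε')`, with a new lower edge `(4,ε')`). -/
def seFlow (B : PreFlow) (vi vc e0 e2 e3 : ℕ) : PreFlow :=
  { V := ((B.V.erase vi).erase vc).image (Nat.pair 0) ∪
         ((B.V.erase vi).erase vc).image (Nat.pair 1) ∪
         {Nat.pair 2 0, Nat.pair 2 1} ∪
         (B.E.filter (fun e => B.up e = none)).image (Nat.pair 3) ∪
         (B.E.filter (fun e => B.lo e = none)).image (Nat.pair 4),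
    E := (B.E.erase e0).image (Nat.pair 0) ∪
         (B.E.erase e0).image (fun e => if e = e3 then Nat.pair 0 e2 else Nat.pair 1 e) ∪
         (B.E.filter (fun e => B.up e = none)).image (Nat.pair 3) ∪
         (B.E.filter (fun e => B.lo e = none)).image (Nat.pair 4),
    η := fun x =>
      if (Nat.unpair x).1 = 2 then
        (if (Nat.unpair x).2 = 0 then FlowLabel.awDown else FlowLabel.awUp)
      else if (Nat.unpair x).1 = 3 then FlowLabel.acUp
      else if (Nat.unpair x).1 = 4 then FlowLabel.acDown
      else B.η (Nat.unpair x).2,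
    up := fun x =>
      let t := (Nat.unpair x).1
      let y := (Nat.unpair x).2
      if t = 0 then
        (if y = e2 then
          (match B.up e3 with
           | some v => some (Nat.pair 1 v)
           | none => some (Nat.pair 3 e3))
        else
          (match B.up y with
           | some v => some (Nat.pair 0 v)
           | none => some (Nat.pair 3 y)))
      else if t = 1 then
        (if y = e2 then some (Nat.pair 2 0)
        else
          (match B.up y with
           | some v => some (Nat.pair 1 v)
           | none => some (Nat.pair 3 y)))
      else if t = 3 then none
      else some (Nat.pair 4 y),
    lo := fun x =>
      let t := (Nat.unpair x).1
      let y := (Nat.unpair x).2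
      if t = 0 then
        (if y = e2 then
          (match B.lo e2 with
           | some v => some (Nat.pair 0 v)
           | none => some (Nat.pair 4 e2))
        else if y = e3 then some (Nat.pair 2 1)
        else
          (match B.lo y with
           | some v => some (Nat.pair 0 v)
           | none => some (Nat.pair 4 y)))
      else if t = 1 then
        (match B.lo y with
         | some v => some (Nat.pair 1 v)
         | none => some (Nat.pair 4 y))
      else if t = 3 then some (Nat.pair 3 y)
      else none }

/-- The reduction `→se`: elimination of a simple edge (up to flow
isomorphism). -/
def RedSE (B C : PreFlow) : Prop :=
  ∃ vi vc e0 e2 e3,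
    vi ∈ B.V ∧ vc ∈ B.V ∧ vi ≠ vc ∧
    B.η vi = .aiDown ∧ B.η vc = .aiUp ∧
    e0 ∈ B.E ∧ e2 ∈ B.E ∧ e3 ∈ B.E ∧
    e0 ≠ e2 ∧ e0 ≠ e3 ∧ e2 ≠ e3 ∧
    B.up e0 = some vi ∧ B.lo e0 = some vc ∧
    B.up e2 = some vi ∧ B.lo e3 = some vc ∧
    Nonempty (FlowIso C (seFlow B vi vc e0 e2 e3))

/-! ### The atomic flow associated with a derivation. -/

/-- Correspondence conditions for a linear rule applied at position `q`:
for each pair `(c₁, c₂)` in `cs`, occurrences at `q ++ c₁ ++ p` in the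
conclusion (formula `i+1`) are traced to occurrences at `q ++ c₂ ++ p` in
the premiss (formula `i`). -/
def corrCond (f : ℕ → List Bool → ℕ) (i : ℕ) (q : List Bool) (ψ : Formula)
    (cs : List (List Bool × List Bool)) : Prop :=
  ∀ c ∈ cs, ∀ p : List Bool, ψ.IsOcc (q ++ c.1 ++ p) →
    f (i + 1) (q ++ c.1 ++ p) = f i (q ++ c.2 ++ p)

/-- The tracing conditions for one inference step: occurrences in the
context are traced to the same edge, and the active occurrences of a
structural rule are related to the edges of the vertex `v` as prescribed by
its label, while the active occurrences of logical and `=` steps are traced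
to the same edges under the canonical correspondence. -/
def stepCond (A : PreFlow) (f : ℕ → List Bool → ℕ) (v : ℕ) (i : ℕ)
    (r : RuleName) (q : List Bool) (φ ψ : Formula) : Prop :=
  (∀ p, ¬ (q <+: p) → φ.IsOcc p → f (i + 1) p = f i p) ∧
  match r with
  | .aiDown =>
      A.η v = .aiDown ∧
      A.up (f (i + 1) (q ++ [false])) = some v ∧
      A.up (f (i + 1) (q ++ [true])) = some v ∧
      f (i + 1) (q ++ [false]) ≠ f (i + 1) (q ++ [true])
  | .aiUp =>
      A.η v = .aiUp ∧
      A.lo (f i (q ++ [false])) = some v ∧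
      A.lo (f i (q ++ [true])) = some v ∧
      f i (q ++ [false]) ≠ f i (q ++ [true])
  | .awDown => A.η v = .awDown ∧ A.up (f (i + 1) q) = some v
  | .awUp => A.η v = .awUp ∧ A.lo (f i q) = some v
  | .acDown =>
      A.η v = .acDown ∧
      A.lo (f i (q ++ [false])) = some v ∧
      A.lo (f i (q ++ [true])) = some v ∧
      A.up (f (i + 1) q) = some v ∧
      f i (q ++ [false]) ≠ f i (q ++ [true])
  | .acUp =>
      A.η v = .acUp ∧
      A.lo (f i q) = some v ∧
      A.up (f (i + 1) (q ++ [false])) = some v ∧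
      A.up (f (i + 1) (q ++ [true])) = some v ∧
      f (i + 1) (q ++ [false]) ≠ f (i + 1) (q ++ [true])
  | .s => corrCond f i q ψ
      [([false, false], [false]), ([false, true], [true, false]),
       ([true], [true, true])]
  | .m => corrCond f i q ψ
      [([false, false], [false, false]), ([true, false], [false, true]),
       ([false, true], [true, false]), ([true, true], [true, true])]
  | .eqOrComm => corrCond f i q ψ [([false], [true]), ([true], [false])]
  | .eqAndComm => corrCond f i q ψ [([false], [true]), ([true], [false])]
  | .eqOrAssocL => corrCond f i q ψ
      [([false], [false, false]), ([true, false], [false, true]),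
       ([true, true], [true])]
  | .eqOrAssocR => corrCond f i q ψ
      [([false, false], [false]), ([false, true], [true, false]),
       ([true], [true, true])]
  | .eqAndAssocL => corrCond f i q ψ
      [([false], [false, false]), ([true, false], [false, true]),
       ([true, true], [true])]
  | .eqAndAssocR => corrCond f i q ψ
      [([false, false], [false]), ([false, true], [true, false]),
       ([true], [true, true])]
  | .eqOrUnitDel => corrCond f i q ψ [([], [false])]
  | .eqOrUnitAdd => corrCond f i q ψ [([false], [])]
  | .eqAndUnitDel => corrCond f i q ψ [([], [false])]
  | .eqAndUnitAdd => corrCond f i q ψ [([false], [])]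
  | .eqTTDel => True
  | .eqTTAdd => True
  | .eqFFDel => True
  | .eqFFAdd => True

/-- `A` is the atomic flow associated with the derivation `Φ`, where `f`
maps each atom occurrence (formula index, position) of `Φ` to an edge of
`A`, and `g` assigns to each structural inference step its vertex. -/
def IsAssocFlow (Φ : Deriv) (A : PreFlow) (f : ℕ → List Bool → ℕ)
    (g : ℕ → ℕ) : Prop :=
  Φ.WF ∧ A.IsFlow ∧
  (∀ i p, i < Φ.nf → (Φ.fml i).IsOcc p → f i p ∈ A.E) ∧
  (∀ e ∈ A.E, ∃ i p, i < Φ.nf ∧ (Φ.fml i).IsOcc p ∧ f i p = e) ∧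
  (∀ i p p', i < Φ.nf → (Φ.fml i).IsOcc p → (Φ.fml i).IsOcc p' →
    f i p = f i p' → p = p') ∧
  (∀ p, (Φ.fml 0).IsOcc p → A.up (f 0 p) = none) ∧
  (∀ p, (Φ.fml Φ.steps.length).IsOcc p → A.lo (f Φ.steps.length p) = none) ∧
  (∀ i, i < Φ.steps.length → (Φ.stepAt i).1.isStructural = true → g i ∈ A.V) ∧
  (∀ v ∈ A.V, ∃ i, i < Φ.steps.length ∧
    (Φ.stepAt i).1.isStructural = true ∧ g i = v) ∧
  (∀ i j, i < Φ.steps.length → j < Φ.steps.length →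
    (Φ.stepAt i).1.isStructural = true → (Φ.stepAt j).1.isStructural = true →
    g i = g j → i = j) ∧
  (∀ i, i < Φ.steps.length →
    stepCond A f (g i) i (Φ.stepAt i).1 (Φ.stepAt i).2.1
      (Φ.fml i) (Φ.fml (i + 1)))

/-! ### Streamlining. -/

/-- No path from an interaction or weakening vertex to a cointeraction or
coweakening vertex. -/
def NoIWPath (A : PreFlow) : Prop :=
  ¬ ∃ v v' l, v ∈ A.V ∧ v' ∈ A.V ∧
      (A.η v = .aiDown ∨ A.η v = .awDown) ∧
      (A.η v' = .aiUp ∨ A.η v' = .awUp) ∧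
      IsPath A (.ver v) (.ver v') l

/-- `Φ` is a streamlined derivation. -/
def Streamlined (Φ : Deriv) : Prop :=
  ∃ A f g, IsAssocFlow Φ A f g ∧ NoIWPath A

/-- `Φ` is a super-streamlined derivation. -/
def SuperStreamlined (Φ : Deriv) : Prop :=
  ∃ A f g, IsAssocFlow Φ A f g ∧ NoIWPath A ∧ NormalW A

/-- `Φ` is a hyper-streamlined derivation. -/
def HyperStreamlined (Φ : Deriv) : Prop :=
  ∃ A f g, IsAssocFlow Φ A f g ∧ NoIWPath A ∧ NormalW A ∧ NormalC A

end AF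

namespace AF

/-! ### Formulae labelled by edges. -/

/-- Formulae whose atom occurrences are replaced by labels from `X`. -/
inductive LF (X : Type) : Type
  | tt : LF X
  | ff : LF X
  | atm : X → LF X
  | or : LF X → LF X → LF X
  | and : LF X → LF X → LF X

namespace LF

variable {X Y : Type}

/-- Simultaneous substitution of labelled formulae for labels. -/
def bind (σ : X → LF Y) : LF X → LF Y
  | .tt => .tt
  | .ff => .ff
  | .atm x => σ x
  | .or α β => .or (bind σ α) (bind σ β)
  | .and α β => .and (bind σ α) (bind σ β)

/-- The labels occurring in a labelled formula, with multiplicity. -/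
def leaves : LF X → Multiset X
  | .tt => 0
  | .ff => 0
  | .atm x => {x}
  | .or α β => leaves α + leaves β
  | .and α β => leaves α + leaves β

/-- The underlying formula, given the atom `τ x` carried by each label `x`. -/
def erase (τ : X → ℕ × Bool) : LF X → Formula
  | .tt => .tt
  | .ff => .ff
  | .atm x => .atom (τ x).1 (τ x).2
  | .or α β => .or (erase τ α) (erase τ β)
  | .and α β => .and (erase τ α) (erase τ β)

/-- The dual labelled formula (labels are kept). -/
def dual : LF X → LF X
  | .tt => .ff
  | .ff => .tt
  | .atm x => .atm x
  | .or α β => .and (dual α) (dual β)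
  | .and α β => .or (dual α) (dual β)

/-- The label at a position (`d` if there is none). -/
def labAt (d : X) : LF X → List Bool → X
  | .atm x, [] => x
  | .or α _, false :: p => labAt d α p
  | .or _ β, true :: p => labAt d β p
  | .and α _, false :: p => labAt d α p
  | .and _ β, true :: p => labAt d β p
  | _, _ => d

theorem leaves_dual (L : LF X) : L.dual.leaves = L.leaves := by
  induction L <;> simp_all [dual, leaves]

theorem leaves_bind_atm (ρ : X → Y) (L : LF X) :
    (L.bind fun x => .atm (ρ x)).leaves = L.leaves.map ρ := by
  induction L <;> simp_all [bind, leaves]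

theorem bind_congr {σ σ' : X → LF Y} (L : LF X) (h : ∀ x ∈ L.leaves, σ x = σ' x) :
    L.bind σ = L.bind σ' := by
  induction L with
  | tt => rfl
  | ff => rfl
  | atm x => exact h x (by simp [leaves])
  | or α β iα iβ =>
    simp only [bind, iα fun x hx => h x (by simp [leaves, hx]),
      iβ fun x hx => h x (by simp [leaves, hx])]
  | and α β iα iβ =>
    simp only [bind, iα fun x hx => h x (by simp [leaves, hx]),
      iβ fun x hx => h x (by simp [leaves, hx])]

theorem erase_bind_atm {τ : X → ℕ × Bool} {τ' : Y → ℕ × Bool} {ρ : X → Y} (L : LF X)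
    (h : ∀ x ∈ L.leaves, τ' (ρ x) = τ x) :
    (L.bind fun x => .atm (ρ x)).erase τ' = L.erase τ := by
  induction L with
  | tt => rfl
  | ff => rfl
  | atm x => simp only [bind, erase, h x (by simp [leaves])]
  | or α β iα iβ =>
    simp only [bind, erase, iα fun x hx => h x (by simp [leaves, hx]),
      iβ fun x hx => h x (by simp [leaves, hx])]
  | and α β iα iβ =>
    simp only [bind, erase, iα fun x hx => h x (by simp [leaves, hx]),
      iβ fun x hx => h x (by simp [leaves, hx])]

end LF

/-- The trace of a structural inference step: a flow vertex, its label, and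
its upper and lower edges. -/
structure Ev (X : Type) : Type where
  lab : FlowLabel
  v : ℕ
  ups : Multiset X
  los : Multiset X

/-- Relabelling of the edges of an event. -/
def Ev.map {X Y : Type} (ρ : X → Y) (ev : Ev X) : Ev Y :=
  ⟨ev.lab, ev.v, ev.ups.map ρ, ev.los.map ρ⟩

/-- Turning a flow label upside down. -/
def FlowLabel.flip : FlowLabel → FlowLabel
  | .aiDown => .aiUp
  | .aiUp => .aiDown
  | .awDown => .awUp
  | .awUp => .awDown
  | .acDown => .acUp
  | .acUp => .acDown

/-- Turning an event upside down. -/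
def Ev.flip {X : Type} (ev : Ev X) : Ev X := ⟨ev.lab.flip, ev.v, ev.los, ev.ups⟩

/-- The involution on atoms. -/
def negAtom (a : ℕ × Bool) : ℕ × Bool := (a.1, !a.2)

/-- Rule instances on labelled formulae, together with the list of events
(empty for logical and `=` rules) which they produce. -/
inductive LRule {X : Type} (τ : X → ℕ × Bool) :
    RuleName → List (Ev X) → LF X → LF X → Prop
  | aiDown (v : ℕ) (x y : X) (h : τ y = negAtom (τ x)) :
      LRule τ .aiDown [⟨.aiDown, v, 0, {x, y}⟩] .tt (.or (.atm x) (.atm y))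
  | aiUp (v : ℕ) (x y : X) (h : τ y = negAtom (τ x)) :
      LRule τ .aiUp [⟨.aiUp, v, {x, y}, 0⟩] (.and (.atm x) (.atm y)) .ff
  | awDown (v : ℕ) (x : X) : LRule τ .awDown [⟨.awDown, v, 0, {x}⟩] .ff (.atm x)
  | awUp (v : ℕ) (x : X) : LRule τ .awUp [⟨.awUp, v, {x}, 0⟩] (.atm x) .tt
  | acDown (v : ℕ) (x y z : X) (h : τ x = τ z) (h' : τ y = τ z) :
      LRule τ .acDown [⟨.acDown, v, {x, y}, {z}⟩] (.or (.atm x) (.atm y)) (.atm z)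
  | acUp (v : ℕ) (x y z : X) (h : τ x = τ z) (h' : τ y = τ z) :
      LRule τ .acUp [⟨.acUp, v, {z}, {x, y}⟩] (.atm z) (.and (.atm x) (.atm y))
  | s (α β γ : LF X) : LRule τ .s [] (.and α (.or β γ)) (.or (.and α β) γ)
  | m (α β γ δ : LF X) :
      LRule τ .m [] (.or (.and α β) (.and γ δ)) (.and (.or α γ) (.or β δ))
  | eqOrComm (α β : LF X) : LRule τ .eqOrComm [] (.or α β) (.or β α)
  | eqAndComm (α β : LF X) : LRule τ .eqAndComm [] (.and α β) (.and β α)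
  | eqOrAssocL (α β γ : LF X) :
      LRule τ .eqOrAssocL [] (.or (.or α β) γ) (.or α (.or β γ))
  | eqOrAssocR (α β γ : LF X) :
      LRule τ .eqOrAssocR [] (.or α (.or β γ)) (.or (.or α β) γ)
  | eqAndAssocL (α β γ : LF X) :
      LRule τ .eqAndAssocL [] (.and (.and α β) γ) (.and α (.and β γ))
  | eqAndAssocR (α β γ : LF X) :
      LRule τ .eqAndAssocR [] (.and α (.and β γ)) (.and (.and α β) γ)
  | eqOrUnitDel (α : LF X) : LRule τ .eqOrUnitDel [] (.or α .ff) α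
  | eqOrUnitAdd (α : LF X) : LRule τ .eqOrUnitAdd [] α (.or α .ff)
  | eqAndUnitDel (α : LF X) : LRule τ .eqAndUnitDel [] (.and α .tt) α
  | eqAndUnitAdd (α : LF X) : LRule τ .eqAndUnitAdd [] α (.and α .tt)
  | eqTTDel : LRule τ .eqTTDel [] (.or .tt .tt) .tt
  | eqTTAdd : LRule τ .eqTTAdd [] .tt (.or .tt .tt)
  | eqFFDel : LRule τ .eqFFDel [] (.and .ff .ff) .ff
  | eqFFAdd : LRule τ .eqFFAdd [] .ff (.and .ff .ff)

/-- Deep inference steps on labelled formulae. -/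
inductive LStep {X : Type} (τ : X → ℕ × Bool) :
    RuleName → List Bool → List (Ev X) → LF X → LF X → Prop
  | base {r es γ δ} : LRule τ r es γ δ → LStep τ r [] es γ δ
  | orL {r q es α α'} (β : LF X) : LStep τ r q es α α' →
      LStep τ r (false :: q) es (.or α β) (.or α' β)
  | orR {r q es β β'} (α : LF X) : LStep τ r q es β β' →
      LStep τ r (true :: q) es (.or α β) (.or α β')
  | andL {r q es α α'} (β : LF X) : LStep τ r q es α α' →
      LStep τ r (false :: q) es (.and α β) (.and α' β)
  | andR {r q es β δ} (α : LF X) : LStep τ r q es β δ →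
      LStep τ r (true :: q) es (.and α β) (.and α δ)

/-- Derivations on labelled formulae, with the list of their events. -/
inductive Chain {X : Type} (τ : X → ℕ × Bool) : LF X → List (Ev X) → LF X → Prop
  | nil (L : LF X) : Chain τ L [] L
  | cons {r q es evs L L' L''} : LStep τ r q es L L' → Chain τ L' evs L'' →
      Chain τ L (es ++ evs) L''

variable {X Y : Type} {τ : X → ℕ × Bool} {τ' : Y → ℕ × Bool}

theorem LRule.events {r : RuleName} {es : List (Ev X)} {γ δ : LF X}
    (h : LRule τ r es γ δ) :
    (r.isStructural = false ∧ es = []) ∨ (r.isStructural = true ∧ ∃ ev, es = [ev]) := by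
  cases h <;> simp [RuleName.isStructural]

theorem LStep.exists_rule {r : RuleName} {q : List Bool} {es : List (Ev X)} {L L' : LF X}
    (h : LStep τ r q es L L') : ∃ γ δ, LRule τ r es γ δ := by
  induction h with
  | base h => exact ⟨_, _, h⟩
  | _ => assumption

theorem LRule.conserve {r : RuleName} {es : List (Ev X)} {γ δ : LF X}
    (h : LRule τ r es γ δ) :
    γ.leaves + (es.map Ev.los).sum = δ.leaves + (es.map Ev.ups).sum ∧
      (es.map Ev.ups).sum ≤ γ.leaves ∧ (es.map Ev.los).sum ≤ δ.leaves := by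
  cases h <;>
    simp [LF.leaves, add_assoc, add_comm, add_left_comm, ← Multiset.singleton_add]

theorem LStep.conserve {r : RuleName} {q : List Bool} {es : List (Ev X)} {L L' : LF X}
    (h : LStep τ r q es L L') :
    L.leaves + (es.map Ev.los).sum = L'.leaves + (es.map Ev.ups).sum ∧
      (es.map Ev.ups).sum ≤ L.leaves ∧ (es.map Ev.los).sum ≤ L'.leaves := by
  induction h with
  | base h => exact h.conserve
  | orL β h ih =>
    exact ⟨by simp only [LF.leaves]; rw [add_right_comm, ih.1, add_right_comm],
      ih.2.1.trans (Multiset.le_add_right _ _), ih.2.2.trans (Multiset.le_add_right _ _)⟩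
  | orR β h ih =>
    exact ⟨by simp only [LF.leaves]; rw [add_assoc, ih.1, add_assoc],
      ih.2.1.trans (Multiset.le_add_left _ _), ih.2.2.trans (Multiset.le_add_left _ _)⟩
  | andL β h ih =>
    exact ⟨by simp only [LF.leaves]; rw [add_right_comm, ih.1, add_right_comm],
      ih.2.1.trans (Multiset.le_add_right _ _), ih.2.2.trans (Multiset.le_add_right _ _)⟩
  | andR β h ih =>
    exact ⟨by simp only [LF.leaves]; rw [add_assoc, ih.1, add_assoc],
      ih.2.1.trans (Multiset.le_add_left _ _), ih.2.2.trans (Multiset.le_add_left _ _)⟩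

namespace Chain

theorem trans {L L' L'' : LF X} {evs evs' : List (Ev X)}
    (h : Chain τ L evs L') (h' : Chain τ L' evs' L'') : Chain τ L (evs ++ evs') L'' := by
  induction h with
  | nil => exact h'
  | cons s _ ih => rw [List.append_assoc]; exact .cons s (ih h')

theorem step {r : RuleName} {q : List Bool} {es : List (Ev X)} {L L' : LF X}
    (h : LStep τ r q es L L') : Chain τ L es L' := by
  simpa using Chain.cons h (.nil L')

theorem rule {r : RuleName} {es : List (Ev X)} {L L' : LF X}
    (h : LRule τ r es L L') : Chain τ L es L' :=
  step (.base h)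

theorem orL {evs : List (Ev X)} {α α' : LF X} (β : LF X) (h : Chain τ α evs α') :
    Chain τ (.or α β) evs (.or α' β) := by
  induction h with
  | nil => exact .nil _
  | cons s _ ih => exact .cons (.orL β s) ih

theorem orR {evs : List (Ev X)} {β β' : LF X} (α : LF X) (h : Chain τ β evs β') :
    Chain τ (.or α β) evs (.or α β') := by
  induction h with
  | nil => exact .nil _
  | cons s _ ih => exact .cons (.orR α s) ih

theorem andL {evs : List (Ev X)} {α α' : LF X} (β : LF X) (h : Chain τ α evs α') :
    Chain τ (.and α β) evs (.and α' β) := by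
  induction h with
  | nil => exact .nil _
  | cons s _ ih => exact .cons (.andL β s) ih

theorem andR {evs : List (Ev X)} {β β' : LF X} (α : LF X) (h : Chain τ β evs β') :
    Chain τ (.and α β) evs (.and α β') := by
  induction h with
  | nil => exact .nil _
  | cons s _ ih => exact .cons (.andR α s) ih

theorem exists_rule {L L' : LF X} {evs : List (Ev X)} (h : Chain τ L evs L')
    {ev : Ev X} (hev : ev ∈ evs) : ∃ r γ δ, LRule τ r [ev] γ δ := by
  induction h with
  | nil => simp at hev
  | cons s _ ih =>
    rcases List.mem_append.1 hev with h | h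
    · obtain ⟨γ, δ, hr⟩ := s.exists_rule
      rcases hr.events with ⟨-, rfl⟩ | ⟨-, ev', rfl⟩
      · simp at h
      · obtain rfl := List.mem_singleton.1 h
        exact ⟨_, γ, δ, hr⟩
    · exact ih h

theorem conserve {L L' : LF X} {evs : List (Ev X)} (h : Chain τ L evs L') :
    L.leaves + (evs.map Ev.los).sum = L'.leaves + (evs.map Ev.ups).sum := by
  induction h with
  | nil => rfl
  | cons s _ ih =>
    rw [List.map_append, List.map_append, List.sum_append, List.sum_append, ← add_assoc,
      s.conserve.1, add_right_comm, ih, add_assoc, add_comm (List.sum _) (List.sum _)]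

/-- An edge consumed by an event is present initially or was created by an
earlier event. -/
theorem causal {L L' : LF X} {evs : List (Ev X)} (h : Chain τ L evs L')
    {l₁ l₂ : List (Ev X)} {ev : Ev X} (he : evs = l₁ ++ ev :: l₂) {x : X} (hx : x ∈ ev.ups) :
    x ∈ L.leaves ∨ ∃ ev' ∈ l₁, x ∈ ev'.los := by
  induction h generalizing l₁ with
  | nil => simp at he
  | @cons r q es evs L L' L'' s _ ih =>
    obtain ⟨γ, δ, hr⟩ := s.exists_rule
    have hc := s.conserve
    rcases hr.events with ⟨-, rfl⟩ | ⟨-, ev', rfl⟩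
    · simp only [List.map_nil, List.sum_nil, add_zero] at hc
      rw [hc.1]
      exact ih he
    · simp only [List.map_cons, List.map_nil, List.sum_cons, List.sum_nil, add_zero] at hc
      cases l₁ with
      | nil =>
        obtain ⟨rfl, -⟩ := List.cons.inj he
        exact .inl (Multiset.mem_of_le hc.2.1 hx)
      | cons a l =>
        obtain ⟨rfl, h⟩ := List.cons.inj he
        rcases ih h with h | ⟨b, hb, hb'⟩
        · have : x ∈ L.leaves + ev'.los := by
            rw [hc.1]; exact Multiset.mem_add.2 (.inl h)
          rcases Multiset.mem_add.1 this with h | h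
          · exact .inl h
          · exact .inr ⟨ev', by simp, h⟩
        · exact .inr ⟨b, by simp [hb], hb'⟩

end Chain

theorem LRule.bind_nil {r : RuleName} {γ δ : LF X} (τ' : Y → ℕ × Bool) (σ : X → LF Y)
    (h : LRule τ r [] γ δ) : LRule τ' r [] (γ.bind σ) (δ.bind σ) := by
  cases h <;> constructor

theorem LRule.bind_atm {r : RuleName} {γ δ : LF X} {ev : Ev X} {σ : X → LF Y} {ρ : X → Y}
    (h : LRule τ r [ev] γ δ)
    (hσ : ∀ x ∈ ev.ups + ev.los, σ x = .atm (ρ x) ∧ τ' (ρ x) = τ x) :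
    LRule τ' r [ev.map ρ] (γ.bind σ) (δ.bind σ) := by
  cases h <;> simp at hσ <;> simp only [LF.bind, Ev.map, hσ, Multiset.map_zero,
    Multiset.insert_eq_cons, Multiset.map_cons, Multiset.map_singleton] <;>
    constructor <;> simp only [hσ] <;> assumption

/-- Substituting in a labelled derivation, given a simulation of each of its
structural rule instances. -/
theorem Chain.sim {L L' : LF X} {evs : List (Ev X)} (h : Chain τ L evs L')
    {σ : X → LF Y} {T : Ev X → List (Ev Y)}
    (hT : ∀ ev ∈ evs, ∀ r γ δ, LRule τ r [ev] γ δ →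
      Chain τ' (γ.bind σ) (T ev) (δ.bind σ)) :
    Chain τ' (L.bind σ) (evs.flatMap T) (L'.bind σ) := by
  induction h with
  | nil => exact .nil _
  | @cons r q es evs L L' L'' s c ih =>
    rw [List.flatMap_append]
    refine Chain.trans ?_ (ih fun ev hev => hT ev (by simp [hev]))
    replace hT : ∀ ev ∈ es, ∀ r γ δ, LRule τ r [ev] γ δ →
        Chain τ' (γ.bind σ) (T ev) (δ.bind σ) := fun ev hev => hT ev (by simp [hev])
    clear ih c
    induction s with
    | base h =>
      rcases h.events with ⟨-, rfl⟩ | ⟨-, ev', rfl⟩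
      · exact .rule (h.bind_nil τ' σ)
      · simpa using hT ev' (by simp) _ _ _ h
    | orL β _ ih => exact (ih hT).orL _
    | orR β _ ih => exact (ih hT).orR _
    | andL β _ ih => exact (ih hT).andL _
    | andR β _ ih => exact (ih hT).andR _

theorem LRule.dual {r : RuleName} {es : List (Ev X)} {γ δ : LF X} (h : LRule τ r es γ δ) :
    Chain τ δ.dual (es.map Ev.flip).reverse γ.dual := by
  cases h with
  | s α β γ =>
    exact .trans (.rule (.eqAndComm _ _)) (.trans (.andR _ (.rule (.eqOrComm _ _)))
      (.trans (.rule (.s _ _ _)) (.trans (.rule (.eqOrComm _ _))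
        (.orR _ (.rule (.eqAndComm _ _))))))
  | eqOrComm α β => exact .rule (.eqAndComm _ _)
  | eqAndComm α β => exact .rule (.eqOrComm _ _)
  | aiDown v x y h => exact .rule (.aiUp v x y h)
  | aiUp v x y h => exact .rule (.aiDown v x y h)
  | awDown v x => exact .rule (.awUp v x)
  | awUp v x => exact .rule (.awDown v x)
  | acDown v x y z h h' => exact .rule (.acUp v x y z h h')
  | acUp v x y z h h' => exact .rule (.acDown v x y z h h')
  | m α β γ δ => exact .rule (.m _ _ _ _)
  | eqOrAssocL α β γ => exact .rule (.eqAndAssocR _ _ _)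
  | eqOrAssocR α β γ => exact .rule (.eqAndAssocL _ _ _)
  | eqAndAssocL α β γ => exact .rule (.eqOrAssocR _ _ _)
  | eqAndAssocR α β γ => exact .rule (.eqOrAssocL _ _ _)
  | eqOrUnitDel α => exact .rule (.eqAndUnitAdd _)
  | eqOrUnitAdd α => exact .rule (.eqAndUnitDel _)
  | eqAndUnitDel α => exact .rule (.eqOrUnitAdd _)
  | eqAndUnitAdd α => exact .rule (.eqOrUnitDel _)
  | eqTTDel => exact .rule .eqFFAdd
  | eqTTAdd => exact .rule .eqFFDel
  | eqFFDel => exact .rule .eqTTAdd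
  | eqFFAdd => exact .rule .eqTTDel

theorem Chain.dual {L L' : LF X} {evs : List (Ev X)} (h : Chain τ L evs L') :
    Chain τ L'.dual (evs.map Ev.flip).reverse L.dual := by
  induction h with
  | nil => exact .nil _
  | cons s c ih =>
    rw [List.map_append, List.reverse_append]
    refine ih.trans ?_
    clear ih c
    induction s with
    | base h => exact h.dual
    | orL β _ ih => exact ih.andL _
    | orR β _ ih => exact ih.andR _
    | andL β _ ih => exact ih.orL _
    | andR β _ ih => exact ih.orR _

/-! ### Flows realized by labelled derivations. -/

/-- The flow `A` is obtained from a labelled derivation with initial edges `I`,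
final edges `O` and events `evs`. -/
structure Good (A : PreFlow) (I O : Multiset ℕ) (evs : Multiset (Ev ℕ)) : Prop where
  verts : evs.map Ev.v = A.V.val
  born : I + (evs.map Ev.los).sum = A.E.val
  died : O + (evs.map Ev.ups).sum = A.E.val
  top : ∀ e ∈ I, A.up e = none
  bot : ∀ e ∈ O, A.lo e = none
  ev : ∀ ev ∈ evs, A.η ev.v = ev.lab ∧ (∀ e ∈ ev.los, A.up e = some ev.v) ∧
    ∀ e ∈ ev.ups, A.lo e = some ev.v

/-- `A` is the flow of a labelled derivation from `φ` to `ψ`. -/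
def Realizes (A : PreFlow) (φ ψ : Formula) : Prop :=
  ∃ (τ : ℕ → ℕ × Bool) (L L' : LF ℕ) (evs : List (Ev ℕ)), Chain τ L evs L' ∧
    Good A L.leaves L'.leaves evs ∧ L.erase τ = φ ∧ L'.erase τ = ψ

theorem mem_sum_map {ι α : Type} {f : ι → Multiset α} {s : Multiset ι} {x : α} :
    x ∈ (s.map f).sum ↔ ∃ i ∈ s, x ∈ f i := by
  induction s using Multiset.induction with
  | empty => simp
  | cons a s ih => simp [ih]

theorem sum_map_map {ι α β : Type} {f : ι → Multiset α} {s : Multiset ι} {ρ : α → β} :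
    (s.map fun i => (f i).map ρ).sum = (s.map f).sum.map ρ := by
  induction s using Multiset.induction with
  | empty => simp
  | cons a s ih => simp [ih]

namespace Good

variable {A : PreFlow} {I O : Multiset ℕ} {evs : Multiset (Ev ℕ)}

theorem eq_of_v_eq (h : Good A I O evs) {ev ev' : Ev ℕ} (he : ev ∈ evs) (he' : ev' ∈ evs)
    (hv : ev.v = ev'.v) : ev = ev' :=
  Multiset.inj_on_of_nodup_map (h.verts ▸ A.V.nodup) _ he _ he' hv

theorem mem_los (h : Good A I O evs) {ev : Ev ℕ} (he : ev ∈ evs) {x : ℕ} (hx : x ∈ A.E)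
    (hu : A.up x = some ev.v) : x ∈ ev.los := by
  have hx : x ∈ A.E.val := hx
  rw [← h.born, Multiset.mem_add, mem_sum_map] at hx
  rcases hx with hx | ⟨ev', he', hx⟩
  · simp [h.top x hx] at hu
  · have := (h.ev _ he').2.1 x hx
    rw [hu, Option.some_inj] at this
    rwa [h.eq_of_v_eq he he' this]

theorem mem_ups (h : Good A I O evs) {ev : Ev ℕ} (he : ev ∈ evs) {x : ℕ} (hx : x ∈ A.E)
    (hu : A.lo x = some ev.v) : x ∈ ev.ups := by
  have hx : x ∈ A.E.val := hx
  rw [← h.died, Multiset.mem_add, mem_sum_map] at hx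
  rcases hx with hx | ⟨ev', he', hx⟩
  · simp [h.bot x hx] at hu
  · have := (h.ev _ he').2.2 x hx
    rw [hu, Option.some_inj] at this
    rwa [h.eq_of_v_eq he he' this]

theorem mem_E_of_top (h : Good A I O evs) {x : ℕ} (hx : x ∈ I) : x ∈ A.E := by
  change x ∈ A.E.val
  rw [← h.born]; exact Multiset.mem_add.2 (.inl hx)

theorem mem_E_of_bot (h : Good A I O evs) {x : ℕ} (hx : x ∈ O) : x ∈ A.E := by
  change x ∈ A.E.val
  rw [← h.died]; exact Multiset.mem_add.2 (.inl hx)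

theorem mem_E_of_los (h : Good A I O evs) {ev : Ev ℕ} (he : ev ∈ evs) {x : ℕ}
    (hx : x ∈ ev.los) : x ∈ A.E := by
  change x ∈ A.E.val
  rw [← h.born]; exact Multiset.mem_add.2 (.inr (mem_sum_map.2 ⟨ev, he, hx⟩))

theorem mem_E_of_ups (h : Good A I O evs) {ev : Ev ℕ} (he : ev ∈ evs) {x : ℕ}
    (hx : x ∈ ev.ups) : x ∈ A.E := by
  change x ∈ A.E.val
  rw [← h.died]; exact Multiset.mem_add.2 (.inr (mem_sum_map.2 ⟨ev, he, hx⟩))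

end Good

/-! ### Duality. -/

/-- A flow turned upside down. -/
def PreFlow.flip (A : PreFlow) : PreFlow :=
  ⟨A.V, A.E, fun v => (A.η v).flip, A.lo, A.up⟩

/-- The dual of a formula, up to negation of its atoms. -/
def Formula.dual : Formula → Formula
  | .tt => .ff
  | .ff => .tt
  | .atom n b => .atom n b
  | .or α β => .and (dual α) (dual β)
  | .and α β => .or (dual α) (dual β)

theorem Formula.dual_dual (φ : Formula) : φ.dual.dual = φ := by
  induction φ <;> simp_all [Formula.dual]

theorem FlowLabel.flip_flip (l : FlowLabel) : l.flip.flip = l := by cases l <;> rfl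

theorem PreFlow.flip_flip (A : PreFlow) : A.flip.flip = A := by
  simp [PreFlow.flip, FlowLabel.flip_flip]

theorem LF.erase_dual (τ : X → ℕ × Bool) (L : LF X) : L.dual.erase τ = (L.erase τ).dual := by
  induction L <;> simp_all [LF.dual, LF.erase, Formula.dual]

theorem Good.flip {A : PreFlow} {I O : Multiset ℕ} {evs : Multiset (Ev ℕ)}
    (h : Good A I O evs) : Good A.flip O I (evs.map Ev.flip) where
  verts := by simpa [PreFlow.flip, Ev.flip, Function.comp_def] using h.verts
  born := by simpa [PreFlow.flip, Ev.flip, Function.comp_def] using h.died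
  died := by simpa [PreFlow.flip, Ev.flip, Function.comp_def] using h.born
  top := h.bot
  bot := h.top
  ev := by
    intro ev hev
    obtain ⟨ev', hev', rfl⟩ := Multiset.mem_map.1 hev
    obtain ⟨h1, h2, h3⟩ := h.ev ev' hev'
    exact ⟨congrArg FlowLabel.flip h1, h3, h2⟩

theorem Realizes.flip {A : PreFlow} {φ ψ : Formula} (h : Realizes A φ ψ) :
    Realizes A.flip ψ.dual φ.dual := by
  obtain ⟨τ, L, L', evs, hc, hG, rfl, rfl⟩ := h
  refine ⟨τ, L'.dual, L.dual, _, hc.dual, ?_, L'.erase_dual τ, L.erase_dual τ⟩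
  rw [L.leaves_dual, L'.leaves_dual, Multiset.coe_reverse, ← Multiset.map_coe]
  exact hG.flip

theorem Realizes.of_flip {A : PreFlow} {φ ψ : Formula} (h : Realizes A.flip ψ.dual φ.dual) :
    Realizes A φ ψ := by
  simpa only [PreFlow.flip_flip, Formula.dual_dual] using h.flip

/-! ### Local surgery. -/

/-- Replacing the edge `e` and the two vertices which it joins in the flow of a
derivation, by substituting for `e` along the derivation, renaming the other edges
by `ρ`, and simulating the two structural steps. -/
theorem Realizes.surgery {A B : PreFlow} {φ ψ : Formula} (hA : Realizes A φ ψ)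
    {v₁ v₂ e : ℕ} (hv₁ : v₁ ∈ A.V) (hv₂ : v₂ ∈ A.V) (hne : v₁ ≠ v₂)
    (hup : A.up e = some v₁) (hlo : A.lo e = some v₂) (ρ : ℕ → ℕ)
    (hBη : ∀ v ∈ A.V, v ≠ v₁ → v ≠ v₂ → B.η v = A.η v)
    (hBup : ∀ x ∈ A.E, A.up x ≠ some v₁ → A.up x ≠ some v₂ → B.up (ρ x) = A.up x)
    (hBlo : ∀ x ∈ A.E, A.lo x ≠ some v₁ → A.lo x ≠ some v₂ → B.lo (ρ x) = A.lo x)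
    (H : ∀ (τ : ℕ → ℕ × Bool) (ev₁ ev₂ : Ev ℕ), ev₁.v = v₁ → ev₂.v = v₂ →
      ev₁.lab = A.η v₁ → ev₂.lab = A.η v₂ →
      (∃ r γ δ, LRule τ r [ev₁] γ δ) → (∃ r γ δ, LRule τ r [ev₂] γ δ) →
      (∀ x ∈ A.E, A.up x = some v₁ → x ∈ ev₁.los) →
      (∀ x ∈ A.E, A.lo x = some v₁ → x ∈ ev₁.ups) →
      (∀ x ∈ A.E, A.up x = some v₂ → x ∈ ev₂.los) →
      (∀ x ∈ A.E, A.lo x = some v₂ → x ∈ ev₂.ups) →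
      ∃ (τ' : ℕ → ℕ × Bool) (σ : ℕ → LF ℕ) (N₁ N₂ : List (Ev ℕ)),
        (∀ x ∈ A.E, x ≠ e → σ x = .atm (ρ x) ∧ τ' (ρ x) = τ x) ∧
        (∀ r γ δ, LRule τ r [ev₁] γ δ → Chain τ' (γ.bind σ) N₁ (δ.bind σ)) ∧
        (∀ r γ δ, LRule τ r [ev₂] γ δ → Chain τ' (γ.bind σ) N₂ (δ.bind σ)) ∧
        (∀ W, A.V.val = v₁ ::ₘ v₂ ::ₘ W → ((N₁ ++ N₂).map Ev.v : Multiset ℕ) + W = B.V.val) ∧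
        (∀ R, A.E.val = ev₁.los + ev₂.los + R →
          ((N₁ ++ N₂).map Ev.los).sum + R.map ρ = B.E.val) ∧
        (∀ ev ∈ N₁ ++ N₂, B.η ev.v = ev.lab ∧ (∀ x ∈ ev.los, B.up x = some ev.v) ∧
          ∀ x ∈ ev.ups, B.lo x = some ev.v)) :
    Realizes B φ ψ := by
  obtain ⟨τ, L, L', evs, hc, hG, rfl, rfl⟩ := hA
  obtain ⟨ev₁, hev₁, rfl⟩ : ∃ ev ∈ (evs : Multiset (Ev ℕ)), ev.v = v₁ := by
    have : v₁ ∈ A.V.val := hv₁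
    rwa [← hG.verts, Multiset.mem_map] at this
  obtain ⟨ev₂, hev₂, rfl⟩ : ∃ ev ∈ (evs : Multiset (Ev ℕ)), ev.v = v₂ := by
    have : v₂ ∈ A.V.val := hv₂
    rwa [← hG.verts, Multiset.mem_map] at this
  obtain ⟨s, hs⟩ := Multiset.exists_cons_of_mem hev₁
  have hev₂' : ev₂ ∈ s := by
    rw [hs, Multiset.mem_cons] at hev₂
    exact hev₂.resolve_left fun h => hne (h ▸ rfl)
  obtain ⟨rest, rfl⟩ := Multiset.exists_cons_of_mem hev₂'
  have hrest : ∀ ev ∈ rest, ev ∈ (evs : Multiset (Ev ℕ)) ∧ ev.v ≠ ev₁.v ∧ ev.v ≠ ev₂.v := by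
    intro ev hev
    have hn : ((evs : Multiset (Ev ℕ)).map Ev.v).Nodup := hG.verts ▸ A.V.nodup
    rw [hs] at hn
    simp only [Multiset.map_cons, Multiset.nodup_cons, Multiset.mem_cons, Multiset.mem_map,
      not_or, not_exists, not_and] at hn
    exact ⟨by rw [hs]; simp [hev], hn.1.2 ev hev, hn.2.1 ev hev⟩
  obtain ⟨τ', σ, N₁, N₂, hσ, h₁, h₂, hV, hE, hN⟩ := H τ ev₁ ev₂ rfl rfl
    (hG.ev _ hev₁).1.symm (hG.ev _ hev₂).1.symm
    (hc.exists_rule hev₁) (hc.exists_rule hev₂)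
    (fun x hx => hG.mem_los hev₁ hx) (fun x hx => hG.mem_ups hev₁ hx)
    (fun x hx => hG.mem_los hev₂ hx) (fun x hx => hG.mem_ups hev₂ hx)
  let T : Ev ℕ → List (Ev ℕ) := fun ev =>
    if ev.v = ev₁.v then N₁ else if ev.v = ev₂.v then N₂ else [ev.map ρ]
  have hT : ((evs.flatMap T : List (Ev ℕ)) : Multiset (Ev ℕ)) =
      ((N₁ ++ N₂ : List (Ev ℕ)) : Multiset (Ev ℕ)) + rest.map (Ev.map ρ) := by
    have h1 : ((evs.flatMap T : List (Ev ℕ)) : Multiset (Ev ℕ)) =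
        (evs : Multiset (Ev ℕ)).bind fun ev => (T ev : Multiset (Ev ℕ)) :=
      (Multiset.coe_bind evs T).symm
    have h2 : (rest.bind fun ev => (T ev : Multiset (Ev ℕ))) = rest.map (Ev.map ρ) := by
      rw [← Multiset.bind_singleton]
      refine Multiset.bind_congr fun ev hev => ?_
      simp only [T, if_neg (hrest ev hev).2.1, if_neg (hrest ev hev).2.2]
      rfl
    rw [h1, hs, Multiset.cons_bind, Multiset.cons_bind, h2, ← add_assoc]
    simp only [T, if_true, if_neg hne.symm]
    rfl
  have hchain : Chain τ' (L.bind σ) (evs.flatMap T) (L'.bind σ) := by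
    refine hc.sim fun ev hev r γ δ hr => ?_
    have hev : ev ∈ (evs : Multiset (Ev ℕ)) := hev
    by_cases e₁ : ev.v = ev₁.v
    · obtain rfl := hG.eq_of_v_eq hev hev₁ e₁
      simpa only [T, if_true] using h₁ r γ δ hr
    by_cases e₂ : ev.v = ev₂.v
    · obtain rfl := hG.eq_of_v_eq hev hev₂ e₂
      simpa only [T, if_true, if_neg e₁] using h₂ r γ δ hr
    simp only [T, if_neg e₁, if_neg e₂]
    refine .rule (hr.bind_atm fun x hx => ?_)
    rcases Multiset.mem_add.1 hx with hx | hx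
    · refine hσ x (hG.mem_E_of_ups hev hx) ?_
      rintro rfl
      rw [(hG.ev _ hev).2.2 x hx, Option.some_inj] at hlo
      exact e₂ hlo
    · refine hσ x (hG.mem_E_of_los hev hx) ?_
      rintro rfl
      rw [(hG.ev _ hev).2.1 x hx, Option.some_inj] at hup
      exact e₁ hup
  have hL : ∀ x ∈ L.leaves, σ x = .atm (ρ x) ∧ τ' (ρ x) = τ x := fun x hx =>
    hσ x (hG.mem_E_of_top hx) (by rintro rfl; simp [hG.top x hx] at hup)
  have hL' : ∀ x ∈ L'.leaves, σ x = .atm (ρ x) ∧ τ' (ρ x) = τ x := fun x hx =>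
    hσ x (hG.mem_E_of_bot hx) (by rintro rfl; simp [hG.bot x hx] at hlo)
  rw [L.bind_congr fun x hx => (hL x hx).1, L'.bind_congr fun x hx => (hL' x hx).1] at hchain
  have hborn : L.leaves.map ρ + (((evs.flatMap T : List (Ev ℕ)) : Multiset (Ev ℕ)).map
      Ev.los).sum = B.E.val := by
    rw [← hE (L.leaves + (rest.map Ev.los).sum), hT]
    · simp only [Multiset.map_add, Multiset.sum_add, Multiset.map_map, Function.comp_def,
        Ev.map, sum_map_map, Multiset.map_coe, Multiset.sum_coe]
      abel
    · rw [← hG.born, hs]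
      simp only [Multiset.map_cons, Multiset.sum_cons]
      abel
  refine ⟨τ', _, _, _, hchain, ?_, LF.erase_bind_atm _ fun x hx => (hL x hx).2,
    LF.erase_bind_atm _ fun x hx => (hL' x hx).2⟩
  rw [LF.leaves_bind_atm, LF.leaves_bind_atm]
  refine ⟨?_, hborn, ?_, ?_, ?_, ?_⟩
  · rw [← hV (rest.map Ev.v), hT]
    · simp [Ev.map, Function.comp_def]
    · rw [← hG.verts, hs]; simp
  · have := hchain.conserve
    rw [LF.leaves_bind_atm, LF.leaves_bind_atm] at this
    rw [← hborn, Multiset.map_coe, Multiset.map_coe, Multiset.sum_coe, Multiset.sum_coe, this]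
  · intro x hx
    obtain ⟨y, hy, rfl⟩ := Multiset.mem_map.1 hx
    have := hG.top y hy
    rw [hBup y (hG.mem_E_of_top hy) (by simp [this]) (by simp [this]), this]
  · intro x hx
    obtain ⟨y, hy, rfl⟩ := Multiset.mem_map.1 hx
    have := hG.bot y hy
    rw [hBlo y (hG.mem_E_of_bot hy) (by simp [this]) (by simp [this]), this]
  · rw [hT]
    intro ev hev
    rcases Multiset.mem_add.1 hev with hev | hev
    · exact hN ev hev
    · obtain ⟨ev', hev', rfl⟩ := Multiset.mem_map.1 hev
      obtain ⟨hm, hn₁, hn₂⟩ := hrest ev' hev'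
      obtain ⟨k₁, k₂, k₃⟩ := hG.ev ev' hm
      refine ⟨?_, fun x hx => ?_, fun x hx => ?_⟩
      · have : ev'.v ∈ A.V.val := hG.verts ▸ Multiset.mem_map_of_mem _ hm
        exact (hBη ev'.v this hn₁ hn₂).trans k₁
      · obtain ⟨y, hy, rfl⟩ := Multiset.mem_map.1 hx
        rw [hBup y (hG.mem_E_of_los hm hy) (by simp [k₂ y hy, hn₁]) (by simp [k₂ y hy, hn₂]),
          k₂ y hy]
        rfl
      · obtain ⟨y, hy, rfl⟩ := Multiset.mem_map.1 hx
        rw [hBlo y (hG.mem_E_of_ups hm hy) (by simp [k₃ y hy, hn₁]) (by simp [k₃ y hy, hn₂]),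
          k₃ y hy]
        rfl

/-! ### The reductions on realized flows. -/

namespace LRule

variable {r : RuleName} {ev : Ev X} {γ δ : LF X} {x y z : X}

theorem inv_awDown (h : LRule τ r [ev] γ δ) (hl : ev.lab = .awDown) (hx : x ∈ ev.los) :
    ev = ⟨.awDown, ev.v, 0, {x}⟩ ∧ γ = .ff ∧ δ = .atm x := by
  cases h <;> simp_all

theorem inv_awUp (h : LRule τ r [ev] γ δ) (hl : ev.lab = .awUp) (hx : x ∈ ev.ups) :
    ev = ⟨.awUp, ev.v, {x}, 0⟩ ∧ γ = .atm x ∧ δ = .tt := by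
  cases h <;> simp_all

theorem inv_aiUp (h : LRule τ r [ev] γ δ) (hl : ev.lab = .aiUp) (hx : x ∈ ev.ups)
    (hy : y ∈ ev.ups) (hxy : x ≠ y) :
    ev = ⟨.aiUp, ev.v, {x, y}, 0⟩ ∧ τ y = negAtom (τ x) ∧
      (γ = .and (.atm x) (.atm y) ∨ γ = .and (.atm y) (.atm x)) ∧ δ = .ff := by
  cases h with
  | aiUp v a b h =>
    simp only [Multiset.insert_eq_cons, Multiset.mem_cons, Multiset.mem_singleton] at hx hy
    rcases hx with rfl | rfl <;> rcases hy with rfl | rfl <;>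
      simp_all [negAtom] <;>
      exact Multiset.pair_comm _ _
  | _ => simp_all

theorem inv_acDown (h : LRule τ r [ev] γ δ) (hl : ev.lab = .acDown) (hx : x ∈ ev.ups)
    (hy : y ∈ ev.ups) (hxy : x ≠ y) (hz : z ∈ ev.los) :
    ev = ⟨.acDown, ev.v, {x, y}, {z}⟩ ∧ (τ x = τ z ∧ τ y = τ z) ∧
      (γ = .or (.atm x) (.atm y) ∨ γ = .or (.atm y) (.atm x)) ∧ δ = .atm z := by
  cases h with
  | acDown v a b c h h' =>
    simp only [Multiset.insert_eq_cons, Multiset.mem_cons, Multiset.mem_singleton] at hx hy hz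
    rcases hx with rfl | rfl <;> rcases hy with rfl | rfl <;>
      simp_all <;>
      exact Multiset.pair_comm _ _
  | _ => simp_all

theorem inv_acUp (h : LRule τ r [ev] γ δ) (hl : ev.lab = .acUp) (hx : x ∈ ev.los)
    (hy : y ∈ ev.los) (hxy : x ≠ y) (hz : z ∈ ev.ups) :
    ev = ⟨.acUp, ev.v, {z}, {x, y}⟩ ∧ (τ x = τ z ∧ τ y = τ z) ∧
      γ = .atm z ∧ (δ = .and (.atm x) (.atm y) ∨ δ = .and (.atm y) (.atm x)) := by
  cases h with
  | acUp v a b c h h' =>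
    simp only [Multiset.insert_eq_cons, Multiset.mem_cons, Multiset.mem_singleton] at hx hy hz
    rcases hx with rfl | rfl <;> rcases hy with rfl | rfl <;>
      simp_all <;>
      exact Multiset.pair_comm _ _
  | _ => simp_all

end LRule

theorem Realizes.redWdCd {A B : PreFlow} {φ ψ : Formula} (h : RedWdCd A B)
    (hA : Realizes A φ ψ) : Realizes B φ ψ := by
  obtain ⟨v₁, v₂, e, e₂, e₃, hv₁, hv₂, hne, hη₁, hη₂, he, he₂, he₃, h12, h13, h23,
    hu, hl, hl₂, hu₃, hV, hE, hη, hup, hlo⟩ := h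
  refine hA.surgery hv₁ hv₂ hne hu hl (fun x => if x = e₃ then e₂ else x)
    (fun v _ _ _ => by rw [hη]) ?_ ?_ ?_
  · intro x hx n₁ n₂
    have : x ≠ e₃ := by rintro rfl; exact n₂ hu₃
    simp [this, hup]
  · intro x hx n₁ n₂
    have : x ≠ e₂ := by rintro rfl; exact n₂ hl₂
    by_cases hx3 : x = e₃ <;> simp [hx3, hlo, this]
  rintro τ ev₁ ev₂ rfl rfl l₁ l₂ ⟨r₁, γ₁, δ₁, k₁⟩ ⟨r₂, γ₂, δ₂, k₂⟩ m₁ m₂ m₃ m₄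
  rw [hη₁] at l₁
  rw [hη₂] at l₂
  have i₁ := fun r γ δ (k : LRule τ r [ev₁] γ δ) => k.inv_awDown l₁ (m₁ e he hu)
  have i₂ := fun r γ δ (k : LRule τ r [ev₂] γ δ) =>
    k.inv_acDown l₂ (m₄ e he hl) (m₄ e₂ he₂ hl₂) h12 (m₃ e₃ he₃ hu₃)
  obtain ⟨t₁, t₂⟩ := (i₂ _ _ _ k₂).2.1
  refine ⟨τ, fun x => if x = e then .ff else .atm (if x = e₃ then e₂ else x), [], [],
    ?_, ?_, ?_, ?_, ?_, by simp⟩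
  · intro x hx hxe
    by_cases hx3 : x = e₃ <;> simp [hxe, hx3, h13.symm, t₂]
  · intro r γ δ k
    obtain ⟨-, rfl, rfl⟩ := i₁ r γ δ k
    simpa [LF.bind] using Chain.nil _
  · intro r γ δ k
    obtain ⟨-, -, rfl | rfl, rfl⟩ := i₂ r γ δ k <;>
      simp only [LF.bind, h12.symm, h13.symm, h23, if_true, if_false]
    · exact .trans (evs := []) (.rule (.eqOrComm _ _)) (.rule (.eqOrUnitDel _))
    · exact .rule (.eqOrUnitDel _)
  · intro W hW
    simp [hV, hW]
  · intro R hR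
    rw [(i₁ _ _ _ k₁).1, (i₂ _ _ _ k₂).1] at hR
    have hn := A.E.nodup
    rw [hR] at hn
    have : e₃ ∉ R := by
      simp only [Multiset.singleton_add, Multiset.cons_add, Multiset.nodup_cons] at hn
      exact hn.2.1
    have hR' : R.map (fun x => if x = e₃ then e₂ else x) = R.map id :=
      Multiset.map_congr rfl fun x hx => by
        rw [if_neg]; rfl
        rintro rfl; exact this hx
    rw [hR', hE]
    simp [hR]

theorem Realizes.redWdIu {A B : PreFlow} {φ ψ : Formula} (h : RedWdIu A B)
    (hA : Realizes A φ ψ) : Realizes B φ ψ := by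
  obtain ⟨v₁, v₂, e, e₂, hv₁, hv₂, hne, hη₁, hη₂, he, he₂, h12,
    hu, hl, hl₂, hV, hE, hη, hup, hlo⟩ := h
  refine hA.surgery hv₁ hv₂ hne hu hl id
    (fun v _ _ n => by simp [hη, n]) (by simp [hup]) (by simp [hlo]) ?_
  rintro τ ev₁ ev₂ rfl rfl l₁ l₂ ⟨r₁, γ₁, δ₁, k₁⟩ ⟨r₂, γ₂, δ₂, k₂⟩ m₁ m₂ m₃ m₄
  rw [hη₁] at l₁
  rw [hη₂] at l₂
  have i₁ := fun r γ δ (k : LRule τ r [ev₁] γ δ) => k.inv_awDown l₁ (m₁ e he hu)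
  have i₂ := fun r γ δ (k : LRule τ r [ev₂] γ δ) =>
    k.inv_aiUp l₂ (m₄ e he hl) (m₄ e₂ he₂ hl₂) h12
  refine ⟨τ, fun x => if x = e then .ff else .atm x, [], [⟨.awUp, ev₂.v, {e₂}, 0⟩],
    ?_, ?_, ?_, ?_, ?_, ?_⟩
  · intro x hx hxe
    simp [hxe]
  · intro r γ δ k
    obtain ⟨-, rfl, rfl⟩ := i₁ r γ δ k
    simpa [LF.bind] using Chain.nil _
  · intro r γ δ k
    have key : Chain τ (.and .ff (.atm e₂)) [⟨.awUp, ev₂.v, {e₂}, 0⟩] .ff :=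
      .trans (evs' := []) (.andR _ (.rule (.awUp _ _))) (.rule (.eqAndUnitDel _))
    obtain ⟨-, -, rfl | rfl, rfl⟩ := i₂ r γ δ k <;>
      simp only [LF.bind, h12.symm, if_true, if_false]
    · exact key
    · exact .trans (evs := []) (.rule (.eqAndComm _ _)) key
  · intro W hW
    simp [hV, hW]
  · intro R hR
    rw [(i₁ _ _ _ k₁).1, (i₂ _ _ _ k₂).1] at hR
    simp [hE, hR]
  · simp [hη, hlo, hl₂]

theorem Realizes.redWdWu {A B : PreFlow} {φ ψ : Formula} (h : RedWdWu A B)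
    (hA : Realizes A φ ψ) : Realizes B φ ψ := by
  obtain ⟨v₁, v₂, e, hv₁, hv₂, hne, hη₁, hη₂, he, hu, hl, hV, hE, hη, hup, hlo⟩ := h
  refine hA.surgery hv₁ hv₂ hne hu hl id
    (fun v _ _ n => by simp [hη]) (by simp [hup]) (by simp [hlo]) ?_
  rintro τ ev₁ ev₂ rfl rfl l₁ l₂ ⟨r₁, γ₁, δ₁, k₁⟩ ⟨r₂, γ₂, δ₂, k₂⟩ m₁ m₂ m₃ m₄
  rw [hη₁] at l₁
  rw [hη₂] at l₂
  have i₁ := fun r γ δ (k : LRule τ r [ev₁] γ δ) => k.inv_awDown l₁ (m₁ e he hu)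
  have i₂ := fun r γ δ (k : LRule τ r [ev₂] γ δ) => k.inv_awUp l₂ (m₄ e he hl)
  refine ⟨τ, fun x => if x = e then .ff else .atm x, [], [], ?_, ?_, ?_, ?_, ?_, by simp⟩
  · intro x hx hxe
    simp [hxe]
  · intro r γ δ k
    obtain ⟨-, rfl, rfl⟩ := i₁ r γ δ k
    simpa [LF.bind] using Chain.nil _
  · intro r γ δ k
    obtain ⟨-, rfl, rfl⟩ := i₂ r γ δ k
    simp only [LF.bind, if_true]
    exact .trans (evs := []) (.rule (.eqAndUnitAdd _))
      (.trans (evs := []) (.andR _ (.rule .eqTTAdd))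
      (.trans (evs := []) (.rule (.s _ _ _))
      (.trans (evs := []) (.orL _ (.rule (.eqAndUnitDel _)))
      (.trans (evs := []) (.rule (.eqOrComm _ _)) (.rule (.eqOrUnitDel _))))))
  · intro W hW
    simp [hV, hW]
  · intro R hR
    rw [(i₁ _ _ _ k₁).1, (i₂ _ _ _ k₂).1] at hR
    simp [hE, hR]

theorem Realizes.redWdCu {A B : PreFlow} {φ ψ : Formula} (h : RedWdCu A B)
    (hA : Realizes A φ ψ) : Realizes B φ ψ := by
  obtain ⟨v₁, v₂, e, e₁, e₂, hv₁, hv₂, hne, hη₁, hη₂, he, he₁, he₂, h1, h2, h12,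
    hu, hl, hu₁, hu₂, hV, hE, hη, hup, hlo⟩ := h
  refine hA.surgery hv₁ hv₂ hne hu hl id
    (fun v _ _ n => by simp [hη, n]) ?_ (by simp [hlo]) ?_
  · intro x hx n₁ n₂
    have : x ≠ e₁ := by rintro rfl; exact n₂ hu₁
    simp [hup, this]
  rintro τ ev₁ ev₂ rfl rfl l₁ l₂ ⟨r₁, γ₁, δ₁, k₁⟩ ⟨r₂, γ₂, δ₂, k₂⟩ m₁ m₂ m₃ m₄
  rw [hη₁] at l₁
  rw [hη₂] at l₂
  have i₁ := fun r γ δ (k : LRule τ r [ev₁] γ δ) => k.inv_awDown l₁ (m₁ e he hu)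
  have i₂ := fun r γ δ (k : LRule τ r [ev₂] γ δ) =>
    k.inv_acUp l₂ (m₃ e₁ he₁ hu₁) (m₃ e₂ he₂ hu₂) h12 (m₄ e he hl)
  refine ⟨τ, fun x => if x = e then .ff else .atm x, [],
    [⟨.awDown, ev₁.v, 0, {e₁}⟩, ⟨.awDown, ev₂.v, 0, {e₂}⟩],
    ?_, ?_, ?_, ?_, ?_, ?_⟩
  · intro x hx hxe
    simp [hxe]
  · intro r γ δ k
    obtain ⟨-, rfl, rfl⟩ := i₁ r γ δ k
    simpa [LF.bind] using Chain.nil _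
  · intro r γ δ k
    have key : Chain τ .ff [⟨.awDown, ev₁.v, 0, {e₁}⟩, ⟨.awDown, ev₂.v, 0, {e₂}⟩]
        (.and (.atm e₁) (.atm e₂)) :=
      .trans (evs := []) (.rule .eqFFAdd) (.trans (evs := [_]) (.andL _ (.rule (.awDown _ _)))
        (.andR _ (.rule (.awDown _ _))))
    obtain ⟨-, -, rfl, rfl | rfl⟩ := i₂ r γ δ k <;>
      simp only [LF.bind, h1.symm, h2.symm, if_true, if_false]
    · exact key
    · exact .trans (evs' := []) key (.rule (.eqAndComm _ _))
  · intro W hW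
    rw [hV, hW]
    simp only [List.nil_append, List.map_cons, List.map_nil, ← Multiset.cons_coe,
      Multiset.coe_nil, ← Multiset.singleton_add]
    abel
  · intro R hR
    rw [(i₁ _ _ _ k₁).1, (i₂ _ _ _ k₂).1] at hR
    rw [hE, Finset.erase_val, hR]
    simp [Multiset.cons_swap e₁ e]
  · simp [hη, hup, hη₁, hne, hu₂, h12.symm]

theorem Realizes.redCdIu {A B : PreFlow} {φ ψ : Formula} (h : RedCdIu A B)
    (hA : Realizes A φ ψ) : Realizes B φ ψ := by
  obtain ⟨v₁, v₂, v₃, e, e₁, e₂, e₃, g₁, g₂, hv₁, hv₂, hne, hv₃, hη₁, hη₂, he, he₁, he₂, he₃,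
    h1, h2, h3, h12, h13, h23, hg₁, hg₂, hg, hl₁, hl₂, hu, hl, hl₃, hV, hE, hη, hup, hlo⟩ := h
  have hG : ∀ x ∈ A.E, x ≠ g₁ ∧ x ≠ g₂ := fun x hx =>
    ⟨by rintro rfl; exact hg₁ hx, by rintro rfl; exact hg₂ hx⟩
  have hv₃' : ∀ v ∈ A.V, v ≠ v₃ := by rintro v hv rfl; exact hv₃ hv
  refine hA.surgery hv₁ hv₂ hne hu hl id
    (fun v hv n _ => by simp [hη, n, hv₃' v hv]) ?_ ?_ ?_
  · intro x hx n₁ n₂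
    simp [hup, hG x hx]
  · intro x hx n₁ n₂
    have a₁ : x ≠ e₁ := by rintro rfl; exact n₁ hl₁
    have a₂ : x ≠ e₂ := by rintro rfl; exact n₁ hl₂
    have a₃ : x ≠ e₃ := by rintro rfl; exact n₂ hl₃
    simp [hlo, hG x hx, a₁, a₂, a₃]
  rintro τ ev₁ ev₂ rfl rfl l₁ l₂ ⟨r₁, γ₁, δ₁, k₁⟩ ⟨r₂, γ₂, δ₂, k₂⟩ m₁ m₂ m₃ m₄
  rw [hη₁] at l₁
  rw [hη₂] at l₂
  have i₁ := fun r γ δ (k : LRule τ r [ev₁] γ δ) =>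
    k.inv_acDown l₁ (m₂ e₁ he₁ hl₁) (m₂ e₂ he₂ hl₂) h12 (m₁ e he hu)
  have i₂ := fun r γ δ (k : LRule τ r [ev₂] γ δ) =>
    k.inv_aiUp l₂ (m₄ e₃ he₃ hl₃) (m₄ e he hl) h3.symm
  obtain ⟨t₁, t₂⟩ := (i₁ _ _ _ k₁).2.1
  have t₃ := (i₂ _ _ _ k₂).2.1
  let τ' := Function.update (Function.update τ g₁ (τ e₃)) g₂ (τ e₃)
  have hτ' : ∀ x ∈ A.E, τ' x = τ x := fun x hx => by simp [τ', hG x hx]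
  have hτg₁ : τ' g₁ = τ e₃ := by simp [τ', hg]
  have hτg₂ : τ' g₂ = τ e₃ := by simp [τ']
  refine ⟨τ', fun x => if x = e then .or (.atm e₁) (.atm e₂) else .atm x, [],
    [⟨.acUp, ev₁.v, {e₃}, {g₁, g₂}⟩, ⟨.aiUp, v₃, {g₂, e₂}, 0⟩, ⟨.aiUp, ev₂.v, {g₁, e₁}, 0⟩],
    ?_, ?_, ?_, ?_, ?_, ?_⟩
  · intro x hx hxe
    simp [hxe, hτ' x hx]
  · intro r γ δ k
    obtain ⟨-, -, rfl | rfl, rfl⟩ := i₁ r γ δ k <;>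
      simp only [LF.bind, h1.symm, h2.symm, if_true, if_false]
    · exact .nil _
    · exact .rule (.eqOrComm _ _)
  · intro r γ δ k
    have key : Chain τ' (.and (.atm e₃) (.or (.atm e₁) (.atm e₂)))
        [⟨.acUp, ev₁.v, {e₃}, {g₁, g₂}⟩, ⟨.aiUp, v₃, {g₂, e₂}, 0⟩,
          ⟨.aiUp, ev₂.v, {g₁, e₁}, 0⟩] .ff := by
      refine .trans (evs := [_]) (.andL _ (.rule (.acUp _ g₁ g₂ _ ?_ ?_)))
        (.trans (evs := []) (.rule (.eqAndAssocL _ _ _))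
        (.trans (evs := []) (.andR _ (.andR _ (.rule (.eqOrComm _ _))))
        (.trans (evs := []) (.andR _ (.rule (.s _ _ _)))
        (.trans (evs := [_]) (.andR _ (.orL _ (.rule (.aiUp _ _ _ ?_))))
        (.trans (evs := []) (.andR _ (.rule (.eqOrComm _ _)))
        (.trans (evs := []) (.andR _ (.rule (.eqOrUnitDel _)))
        (.rule (.aiUp _ _ _ ?_))))))))
      · rw [hτg₁, hτ' e₃ he₃]
      · rw [hτg₂, hτ' e₃ he₃]
      · rw [hτg₂, hτ' e₂ he₂, t₂, t₃]
      · rw [hτg₁, hτ' e₁ he₁, t₁, t₃]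
    obtain ⟨-, -, rfl | rfl, rfl⟩ := i₂ r γ δ k <;>
      simp only [LF.bind, h3.symm, if_true, if_false]
    · exact key
    · exact .trans (evs := []) (.rule (.eqAndComm _ _)) key
  · intro W hW
    rw [hV, Finset.insert_val_of_notMem hv₃, hW]
    simp only [List.nil_append, List.map_cons, List.map_nil, ← Multiset.cons_coe,
      Multiset.coe_nil, ← Multiset.singleton_add]
    abel
  · intro R hR
    rw [(i₁ _ _ _ k₁).1, (i₂ _ _ _ k₂).1] at hR
    rw [hE, Finset.insert_val_of_notMem (by simp [hg, hg₁]),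
      Finset.insert_val_of_notMem (by simp [hg₂]), Finset.erase_val, hR]
    simp
  · have := hG e he
    have := hG e₁ he₁
    have := hG e₂ he₂
    have := hG e₃ he₃
    have := hv₃' _ hv₁
    have := hv₃' _ hv₂
    simp_all [Ne.symm]

theorem Realizes.redCdCu {A B : PreFlow} {φ ψ : Formula} (h : RedCdCu A B)
    (hA : Realizes A φ ψ) : Realizes B φ ψ := by
  obtain ⟨v₁, v₂, v₃, v₄, e, e₁, e₂, e₃, e₄, g₁₁, g₁₂, g₂₁, g₂₂, hv₁, hv₂, hne, hv₃, hv₄, hv34,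
    hη₁, hη₂, he, he₁, he₂, he₃, he₄, h1, h2, h3, h4, h12, h13, h14, h23, h24, h34,
    hg₁₁, hg₁₂, hg₂₁, hg₂₂, hg1, hg2, hg3, hg4, hg5, hg6,
    hl₁, hl₂, hu, hl, hu₃, hu₄, hV, hE, hη, hup, hlo⟩ := h
  have hG : ∀ x ∈ A.E, x ≠ g₁₁ ∧ x ≠ g₁₂ ∧ x ≠ g₂₁ ∧ x ≠ g₂₂ := fun x hx =>
    ⟨by rintro rfl; exact hg₁₁ hx, by rintro rfl; exact hg₁₂ hx,
      by rintro rfl; exact hg₂₁ hx, by rintro rfl; exact hg₂₂ hx⟩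
  have hv₃' : ∀ v ∈ A.V, v ≠ v₃ ∧ v ≠ v₄ := fun v hv =>
    ⟨by rintro rfl; exact hv₃ hv, by rintro rfl; exact hv₄ hv⟩
  refine hA.surgery hv₁ hv₂ hne hu hl id
    (fun v hv n n' => by simp [hη, n, n', hv₃' v hv]) ?_ ?_ ?_
  · intro x hx n₁ n₂
    have a₁ : x ≠ e₃ := by rintro rfl; exact n₂ hu₃
    have a₂ : x ≠ e₄ := by rintro rfl; exact n₂ hu₄
    simp [hup, hG x hx, a₁, a₂]
  · intro x hx n₁ n₂
    have a₂ : x ≠ e₂ := by rintro rfl; exact n₁ hl₂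
    simp [hlo, hG x hx, a₂]
  rintro τ ev₁ ev₂ rfl rfl l₁ l₂ ⟨r₁, γ₁, δ₁, k₁⟩ ⟨r₂, γ₂, δ₂, k₂⟩ m₁ m₂ m₃ m₄
  rw [hη₁] at l₁
  rw [hη₂] at l₂
  have i₁ := fun r γ δ (k : LRule τ r [ev₁] γ δ) =>
    k.inv_acDown l₁ (m₂ e₁ he₁ hl₁) (m₂ e₂ he₂ hl₂) h12 (m₁ e he hu)
  have i₂ := fun r γ δ (k : LRule τ r [ev₂] γ δ) =>
    k.inv_acUp l₂ (m₃ e₃ he₃ hu₃) (m₃ e₄ he₄ hu₄) h34 (m₄ e he hl)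
  obtain ⟨t₁, t₂⟩ := (i₁ _ _ _ k₁).2.1
  obtain ⟨t₃, t₄⟩ := (i₂ _ _ _ k₂).2.1
  let τ' : ℕ → ℕ × Bool := fun x => if x ∈ A.E then τ x else τ e
  have hτ' : ∀ x ∈ A.E, τ' x = τ x := fun x hx => by simp [τ', hx]
  have hτg : ∀ x ∉ A.E, τ' x = τ e := fun x hx => by simp [τ', hx]
  refine ⟨τ', fun x => if x = e then .or (.atm e₁) (.atm e₂) else .atm x, [],
    [⟨.acUp, ev₁.v, {e₁}, {g₁₁, g₁₂}⟩, ⟨.acUp, ev₂.v, {e₂}, {g₂₁, g₂₂}⟩,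
      ⟨.acDown, v₃, {g₁₁, g₂₁}, {e₃}⟩, ⟨.acDown, v₄, {g₁₂, g₂₂}, {e₄}⟩],
    ?_, ?_, ?_, ?_, ?_, ?_⟩
  · intro x hx hxe
    simp [hxe, hτ' x hx]
  · intro r γ δ k
    obtain ⟨-, -, rfl | rfl, rfl⟩ := i₁ r γ δ k <;>
      simp only [LF.bind, h1.symm, h2.symm, if_true, if_false]
    · exact .nil _
    · exact .rule (.eqOrComm _ _)
  · intro r γ δ k
    have key : Chain τ' (.or (.atm e₁) (.atm e₂))
        [⟨.acUp, ev₁.v, {e₁}, {g₁₁, g₁₂}⟩, ⟨.acUp, ev₂.v, {e₂}, {g₂₁, g₂₂}⟩,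
          ⟨.acDown, v₃, {g₁₁, g₂₁}, {e₃}⟩, ⟨.acDown, v₄, {g₁₂, g₂₂}, {e₄}⟩]
        (.and (.atm e₃) (.atm e₄)) := by
      refine .trans (evs := [_]) (.orL _ (.rule (.acUp _ g₁₁ g₁₂ _ ?_ ?_)))
        (.trans (evs := [_]) (.orR _ (.rule (.acUp _ g₂₁ g₂₂ _ ?_ ?_)))
        (.trans (evs := []) (.rule (.m _ _ _ _))
        (.trans (evs := [_]) (.andL _ (.rule (.acDown _ _ _ _ ?_ ?_)))
        (.andR _ (.rule (.acDown _ _ _ _ ?_ ?_)))))) <;>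
      simp only [hτ' e₁ he₁, hτ' e₂ he₂, hτ' e₃ he₃, hτ' e₄ he₄, hτg g₁₁ hg₁₁,
        hτg g₁₂ hg₁₂, hτg g₂₁ hg₂₁, hτg g₂₂ hg₂₂, t₁, t₂, t₃, t₄]
    obtain ⟨-, -, rfl, rfl | rfl⟩ := i₂ r γ δ k <;>
      simp only [LF.bind, h3.symm, h4.symm, if_true, if_false]
    · exact key
    · exact .trans (evs' := []) key (.rule (.eqAndComm _ _))
  · intro W hW
    rw [hV, Finset.insert_val_of_notMem (by simp [hv34, hv₃]),
      Finset.insert_val_of_notMem hv₄, hW]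
    simp only [List.nil_append, List.map_cons, List.map_nil, ← Multiset.cons_coe,
      Multiset.coe_nil, ← Multiset.singleton_add]
    abel
  · intro R hR
    rw [(i₁ _ _ _ k₁).1, (i₂ _ _ _ k₂).1] at hR
    rw [hE, Finset.insert_val_of_notMem (by simp [*]),
      Finset.insert_val_of_notMem (by simp [*]),
      Finset.insert_val_of_notMem (by simp [*]),
      Finset.insert_val_of_notMem (by simp [hg₂₂]), Finset.erase_val, hR]
    simp only [List.nil_append, List.map_cons, List.map_nil, List.sum_cons, List.sum_nil,
      Multiset.insert_eq_cons, Multiset.singleton_add, Multiset.cons_add,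
      Multiset.erase_cons_head, Multiset.map_id]
    simp only [← Multiset.singleton_add]
    abel
  · have := hG e he
    have := hG e₁ he₁
    have := hG e₂ he₂
    have := hG e₃ he₃
    have := hG e₄ he₄
    have := hv₃' _ hv₁
    have := hv₃' _ hv₂
    simp_all

theorem RedCuWu.flip {A B : PreFlow} (h : RedCuWu A B) : RedWdCd A.flip B.flip := by
  obtain ⟨v₁, v₂, e, e₂, e₃, hv₁, hv₂, hne, hη₁, hη₂, he, he₂, he₃, h12, h13, h23,
    hu, hl, hl₂, hu₃, hV, hE, hη, hup, hlo⟩ := h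
  exact ⟨v₁, v₂, e, e₂, e₃, hv₁, hv₂, hne, congrArg FlowLabel.flip hη₁,
    congrArg FlowLabel.flip hη₂, he, he₂, he₃, h12, h13, h23, hu, hl, hl₂, hu₃, hV, hE,
    by simp [PreFlow.flip, hη], hup, hlo⟩

theorem FlowLabel.flip_update (η : ℕ → FlowLabel) (v : ℕ) (l : FlowLabel) :
    (fun w => (Function.update η v l w).flip) =
      Function.update (fun w => (η w).flip) v l.flip := by
  funext w
  by_cases h : w = v <;> simp [h]

theorem RedIdWu.flip {A B : PreFlow} (h : RedIdWu A B) : RedWdIu A.flip B.flip := by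
  obtain ⟨v₁, v₂, e, e₂, hv₁, hv₂, hne, hη₁, hη₂, he, he₂, h12,
    hu, hl, hl₂, hV, hE, hη, hup, hlo⟩ := h
  exact ⟨v₁, v₂, e, e₂, hv₁, hv₂, hne, congrArg FlowLabel.flip hη₁,
    congrArg FlowLabel.flip hη₂, he, he₂, h12, hu, hl, hl₂, hV, hE,
    by simp only [PreFlow.flip, hη, FlowLabel.flip_update]; rfl, hlo, hup⟩

theorem RedCdWu.flip {A B : PreFlow} (h : RedCdWu A B) : RedWdCu A.flip B.flip := by
  obtain ⟨v₁, v₂, e, e₁, e₂, hv₁, hv₂, hne, hη₁, hη₂, he, he₁, he₂, h1, h2, h12,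
    hu, hl, hu₁, hu₂, hV, hE, hη, hup, hlo⟩ := h
  exact ⟨v₁, v₂, e, e₁, e₂, hv₁, hv₂, hne, congrArg FlowLabel.flip hη₁,
    congrArg FlowLabel.flip hη₂, he, he₁, he₂, h1, h2, h12, hu, hl, hu₁, hu₂, hV, hE,
    by simp only [PreFlow.flip, hη, FlowLabel.flip_update]; rfl, hup, hlo⟩

theorem RedIdCu.flip {A B : PreFlow} (h : RedIdCu A B) : RedCdIu A.flip B.flip := by
  obtain ⟨v₁, v₂, v₃, e, e₁, e₂, e₃, g₁, g₂, hv₁, hv₂, hne, hv₃, hη₁, hη₂, he, he₁, he₂, he₃,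
    h1, h2, h3, h12, h13, h23, hg₁, hg₂, hg, hl₁, hl₂, hu, hl, hl₃, hV, hE, hη, hup, hlo⟩ := h
  exact ⟨v₁, v₂, v₃, e, e₁, e₂, e₃, g₁, g₂, hv₁, hv₂, hne, hv₃, congrArg FlowLabel.flip hη₁,
    congrArg FlowLabel.flip hη₂, he, he₁, he₂, he₃, h1, h2, h3, h12, h13, h23, hg₁, hg₂, hg,
    hl₁, hl₂, hu, hl, hl₃, hV, hE,
    by simp only [PreFlow.flip, hη, FlowLabel.flip_update]; rfl, hup, hlo⟩

theorem Realizes.red {A B : PreFlow} {φ ψ : Formula} (hA : Realizes A φ ψ)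
    (h : RedWdCd A B ∨ RedCuWu A B ∨ RedWdIu A B ∨ RedIdWu A B ∨
      RedWdWu A B ∨ RedWdCu A B ∨ RedCdWu A B ∨
      RedCdIu A B ∨ RedIdCu A B ∨ RedCdCu A B) : Realizes B φ ψ := by
  rcases h with h | h | h | h | h | h | h | h | h | h
  · exact Realizes.redWdCd h hA
  · exact (Realizes.redWdCd h.flip hA.flip).of_flip
  · exact Realizes.redWdIu h hA
  · exact (Realizes.redWdIu h.flip hA.flip).of_flip
  · exact Realizes.redWdWu h hA
  · exact Realizes.redWdCu h hA
  · exact (Realizes.redWdCu h.flip hA.flip).of_flip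
  · exact Realizes.redCdIu h hA
  · exact (Realizes.redCdIu h.flip hA.flip).of_flip
  · exact Realizes.redCdCu h hA

/-! ### From labelled derivations to derivations. -/

theorem LRule.ruleInstance {r : RuleName} {es : List (Ev X)} {γ δ : LF X}
    (h : LRule τ r es γ δ) : RuleInstance r (γ.erase τ) (δ.erase τ) := by
  cases h <;> simp only [LF.erase, negAtom, *] <;> constructor

theorem Formula.repl_nil (φ ψ : Formula) : φ.repl [] ψ = ψ := by cases φ <;> rfl

theorem Formula.sub_nil (φ : Formula) : φ.sub [] = some φ := by cases φ <;> rfl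

theorem LStep.stepAt {r : RuleName} {q : List Bool} {es : List (Ev X)} {L L' : LF X}
    (h : LStep τ r q es L L') : StepAt r q (L.erase τ) (L'.erase τ) := by
  induction h with
  | base h => exact ⟨_, _, Formula.sub_nil _, h.ruleInstance, (Formula.repl_nil _ _).symm⟩
  | orL β _ ih =>
    obtain ⟨γ, δ, h, hr, he⟩ := ih
    exact ⟨γ, δ, h, hr, by simp only [LF.erase, he, Formula.repl]⟩
  | orR β _ ih =>
    obtain ⟨γ, δ, h, hr, he⟩ := ih
    exact ⟨γ, δ, h, hr, by simp only [LF.erase, he, Formula.repl]⟩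
  | andL β _ ih =>
    obtain ⟨γ, δ, h, hr, he⟩ := ih
    exact ⟨γ, δ, h, hr, by simp only [LF.erase, he, Formula.repl]⟩
  | andR β _ ih =>
    obtain ⟨γ, δ, h, hr, he⟩ := ih
    exact ⟨γ, δ, h, hr, by simp only [LF.erase, he, Formula.repl]⟩

namespace Formula

variable {α β : Formula} {p : List Bool}

theorem isOcc_atom {n : ℕ} {b : Bool} : (Formula.atom n b).IsOcc p ↔ p = [] := by
  cases p <;> simp [IsOcc, sub]

theorem not_isOcc_tt : ¬ Formula.tt.IsOcc p := by cases p <;> simp [IsOcc, sub]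

theorem not_isOcc_ff : ¬ Formula.ff.IsOcc p := by cases p <;> simp [IsOcc, sub]

theorem isOcc_or : (Formula.or α β).IsOcc p ↔
    (∃ p', p = false :: p' ∧ α.IsOcc p') ∨ ∃ p', p = true :: p' ∧ β.IsOcc p' := by
  rcases p with _ | ⟨_ | _, p⟩ <;> simp [IsOcc, sub]

theorem isOcc_and : (Formula.and α β).IsOcc p ↔
    (∃ p', p = false :: p' ∧ α.IsOcc p') ∨ ∃ p', p = true :: p' ∧ β.IsOcc p' := by
  rcases p with _ | ⟨_ | _, p⟩ <;> simp [IsOcc, sub]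

end Formula

namespace LF

theorem labAt_mem {d : X} {L : LF X} {p : List Bool} (h : (L.erase τ).IsOcc p) :
    L.labAt d p ∈ L.leaves := by
  induction L generalizing p with
  | tt => exact absurd h Formula.not_isOcc_tt
  | ff => exact absurd h Formula.not_isOcc_ff
  | atm x =>
    obtain rfl := Formula.isOcc_atom.1 h
    simp [labAt, leaves]
  | or α β iα iβ =>
    rcases Formula.isOcc_or.1 h with ⟨p', rfl, h⟩ | ⟨p', rfl, h⟩
    · exact Multiset.mem_add.2 (.inl (iα h))
    · exact Multiset.mem_add.2 (.inr (iβ h))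
  | and α β iα iβ =>
    rcases Formula.isOcc_and.1 h with ⟨p', rfl, h⟩ | ⟨p', rfl, h⟩
    · exact Multiset.mem_add.2 (.inl (iα h))
    · exact Multiset.mem_add.2 (.inr (iβ h))

theorem exists_labAt (τ : X → ℕ × Bool) (d : X) {L : LF X} {x : X} (h : x ∈ L.leaves) :
    ∃ p, (L.erase τ).IsOcc p ∧ L.labAt d p = x := by
  induction L with
  | tt => simp [leaves] at h
  | ff => simp [leaves] at h
  | atm y =>
    obtain rfl := Multiset.mem_singleton.1 h
    exact ⟨[], Formula.isOcc_atom.2 rfl, rfl⟩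
  | or α β iα iβ =>
    rcases Multiset.mem_add.1 h with h | h
    · obtain ⟨p, hp, rfl⟩ := iα h
      exact ⟨false :: p, hp, rfl⟩
    · obtain ⟨p, hp, rfl⟩ := iβ h
      exact ⟨true :: p, hp, rfl⟩
  | and α β iα iβ =>
    rcases Multiset.mem_add.1 h with h | h
    · obtain ⟨p, hp, rfl⟩ := iα h
      exact ⟨false :: p, hp, rfl⟩
    · obtain ⟨p, hp, rfl⟩ := iβ h
      exact ⟨true :: p, hp, rfl⟩

theorem labAt_inj {d : X} {L : LF X} (hn : L.leaves.Nodup) {p p' : List Bool}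
    (h : (L.erase τ).IsOcc p) (h' : (L.erase τ).IsOcc p')
    (he : L.labAt d p = L.labAt d p') : p = p' := by
  induction L generalizing p p' with
  | tt => exact absurd h Formula.not_isOcc_tt
  | ff => exact absurd h Formula.not_isOcc_ff
  | atm x => rw [Formula.isOcc_atom.1 h, Formula.isOcc_atom.1 h']
  | or α β iα iβ =>
    obtain ⟨n₁, n₂, hd⟩ := Multiset.nodup_add.1 hn
    rcases Formula.isOcc_or.1 h with ⟨p, rfl, h⟩ | ⟨p, rfl, h⟩ <;>
      rcases Formula.isOcc_or.1 h' with ⟨p', rfl, h'⟩ | ⟨p', rfl, h'⟩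
    · rw [iα n₁ h h' he]
    · have he : α.labAt d p = β.labAt d p' := he
      exact absurd (labAt_mem (d := d) (L := β) h')
        (Multiset.disjoint_left.1 hd (he ▸ labAt_mem (d := d) (L := α) h))
    · have he : β.labAt d p = α.labAt d p' := he
      exact absurd (labAt_mem (d := d) (L := β) h)
        (Multiset.disjoint_left.1 hd (he ▸ labAt_mem (d := d) (L := α) h'))
    · rw [iβ n₂ h h' he]
  | and α β iα iβ =>
    obtain ⟨n₁, n₂, hd⟩ := Multiset.nodup_add.1 hn
    rcases Formula.isOcc_and.1 h with ⟨p, rfl, h⟩ | ⟨p, rfl, h⟩ <;>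
      rcases Formula.isOcc_and.1 h' with ⟨p', rfl, h'⟩ | ⟨p', rfl, h'⟩
    · rw [iα n₁ h h' he]
    · have he : α.labAt d p = β.labAt d p' := he
      exact absurd (labAt_mem (d := d) (L := β) h')
        (Multiset.disjoint_left.1 hd (he ▸ labAt_mem (d := d) (L := α) h))
    · have he : β.labAt d p = α.labAt d p' := he
      exact absurd (labAt_mem (d := d) (L := β) h)
        (Multiset.disjoint_left.1 hd (he ▸ labAt_mem (d := d) (L := α) h'))
    · rw [iβ n₂ h h' he]

end LF

/-- The tracing condition of a step, as a relation between the maps sending the atom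
occurrences of its premiss and of its conclusion to edges. -/
def stepRel (A : PreFlow) (v : ℕ) (r : RuleName) (q : List Bool) (φ ψ : Formula)
    (F F' : List Bool → ℕ) : Prop :=
  stepCond A (fun k => if k = 0 then F else F') v 0 r q φ ψ

theorem stepCond_iff {A : PreFlow} {f : ℕ → List Bool → ℕ} {v i : ℕ} {r : RuleName}
    {q : List Bool} {φ ψ : Formula} :
    stepCond A f v i r q φ ψ ↔ stepRel A v r q φ ψ (f i) (f (i + 1)) := by
  cases r <;> simp [stepRel, stepCond, corrCond]

theorem stepRel_cons {A : PreFlow} {v : ℕ} {r : RuleName} {b : Bool} {q : List Bool}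
    {φ ψ φ' ψ' : Formula} {F F' : List Bool → ℕ}
    (hφ : ∀ p, φ'.IsOcc (b :: p) ↔ φ.IsOcc p) (hψ : ∀ p, ψ'.IsOcc (b :: p) ↔ ψ.IsOcc p) :
    stepRel A v r (b :: q) φ' ψ' F F' ↔
      (∀ p, (∀ p', p ≠ b :: p') → φ'.IsOcc p → F' p = F p) ∧
      stepRel A v r q φ ψ (fun p => F (b :: p)) (fun p => F' (b :: p)) := by
  have key : (∀ p, ¬ b :: q <+: p → φ'.IsOcc p → F' p = F p) ↔
      (∀ p, (∀ p', p ≠ b :: p') → φ'.IsOcc p → F' p = F p) ∧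
      ∀ p, ¬ q <+: p → φ.IsOcc p → F' (b :: p) = F (b :: p) := by
    constructor
    · intro h
      refine ⟨fun p hp ho => h p ?_ ho, fun p hp ho => h _ ?_ ((hφ p).2 ho)⟩
      · rintro ⟨t, rfl⟩
        exact hp _ rfl
      · simpa using hp
    · rintro ⟨h, h'⟩ p hp ho
      by_cases hb : ∃ p', p = b :: p'
      · obtain ⟨p', rfl⟩ := hb
        exact h' p' (by simpa using hp) ((hφ p').1 ho)
      · exact h p (fun p' e => hb ⟨p', e⟩) ho
  cases r <;>
    simp [stepRel, stepCond, corrCond, hψ, key, and_assoc]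

theorem LRule.stepRel {A : PreFlow} {v : ℕ} {τ : ℕ → ℕ × Bool} {r : RuleName}
    {es : List (Ev ℕ)} {γ δ : LF ℕ}
    (h : LRule τ r es γ δ) (hn : γ.leaves.Nodup) (hn' : δ.leaves.Nodup)
    (hes : ∀ ev ∈ es, ev.v = v ∧ A.η v = ev.lab ∧ (∀ e ∈ ev.los, A.up e = some v) ∧
      ∀ e ∈ ev.ups, A.lo e = some v) :
    AF.stepRel A v r [] (γ.erase τ) (δ.erase τ) (γ.labAt 0) (δ.labAt 0) := by
  refine ⟨fun p hp => absurd (List.nil_prefix) hp, ?_⟩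
  cases h <;> simp_all [corrCond, LF.labAt, LF.leaves]

theorem LStep.stepRel {A : PreFlow} {v : ℕ} {τ : ℕ → ℕ × Bool} {r : RuleName}
    {q : List Bool} {es : List (Ev ℕ)} {L L' : LF ℕ}
    (h : LStep τ r q es L L') (hn : L.leaves.Nodup) (hn' : L'.leaves.Nodup)
    (hes : ∀ ev ∈ es, ev.v = v ∧ A.η v = ev.lab ∧ (∀ e ∈ ev.los, A.up e = some v) ∧
      ∀ e ∈ ev.ups, A.lo e = some v) :
    AF.stepRel A v r q (L.erase τ) (L'.erase τ) (L.labAt 0) (L'.labAt 0) := by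
  induction h with
  | base h => exact h.stepRel hn hn' hes
  | orL β _ ih =>
    refine (stepRel_cons (fun p => Iff.rfl) fun p => Iff.rfl).2
      ⟨fun p hp ho => ?_, ih (Multiset.nodup_add.1 hn).1 (Multiset.nodup_add.1 hn').1 hes⟩
    rcases Formula.isOcc_or.1 ho with ⟨p', rfl, -⟩ | ⟨p', rfl, -⟩
    · exact absurd rfl (hp _)
    · rfl
  | orR β _ ih =>
    refine (stepRel_cons (fun p => Iff.rfl) fun p => Iff.rfl).2
      ⟨fun p hp ho => ?_, ih (Multiset.nodup_add.1 hn).2.1 (Multiset.nodup_add.1 hn').2.1 hes⟩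
    rcases Formula.isOcc_or.1 ho with ⟨p', rfl, -⟩ | ⟨p', rfl, -⟩
    · rfl
    · exact absurd rfl (hp _)
  | andL β _ ih =>
    refine (stepRel_cons (fun p => Iff.rfl) fun p => Iff.rfl).2
      ⟨fun p hp ho => ?_, ih (Multiset.nodup_add.1 hn).1 (Multiset.nodup_add.1 hn').1 hes⟩
    rcases Formula.isOcc_and.1 ho with ⟨p', rfl, -⟩ | ⟨p', rfl, -⟩
    · exact absurd rfl (hp _)
    · rfl
  | andR β _ ih =>
    refine (stepRel_cons (fun p => Iff.rfl) fun p => Iff.rfl).2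
      ⟨fun p hp ho => ?_, ih (Multiset.nodup_add.1 hn).2.1 (Multiset.nodup_add.1 hn').2.1 hes⟩
    rcases Formula.isOcc_and.1 ho with ⟨p', rfl, -⟩ | ⟨p', rfl, -⟩
    · rfl
    · exact absurd rfl (hp _)

/-- The successive formulae and steps of a labelled derivation. -/
theorem Chain.exists_seq {L L' : LF X} {evs : List (Ev X)} (h : Chain τ L evs L') :
    ∃ (n : ℕ) (Ls : ℕ → LF X) (rs : ℕ → RuleName) (qs : ℕ → List Bool)
      (es : ℕ → List (Ev X)), Ls 0 = L ∧ Ls n = L' ∧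
      (∀ i < n, LStep τ (rs i) (qs i) (es i) (Ls i) (Ls (i + 1))) ∧
      evs = (List.range n).flatMap es := by
  induction h with
  | nil L => exact ⟨0, fun _ => L, fun _ => .s, fun _ => [], fun _ => [], rfl, rfl, by simp, rfl⟩
  | @cons r q es evs L L' L'' s _ ih =>
    obtain ⟨n, Ls, rs, qs, es', h0, h1, h2, h3⟩ := ih
    refine ⟨n + 1, fun i => Nat.casesOn i L Ls, fun i => Nat.casesOn i r rs,
      fun i => Nat.casesOn i q qs, fun i => Nat.casesOn i es es', rfl, h1, ?_, ?_⟩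
    · rintro (_ | i) hi
      · change LStep τ r q es L (Ls 0)
        rwa [h0]
      · exact h2 i (by omega)
    · rw [List.range_succ_eq_map, List.flatMap_cons, List.flatMap_map, h3]
      rfl

theorem Chain.of_seq {n : ℕ} {Ls : ℕ → LF X} {rs : ℕ → RuleName} {qs : ℕ → List Bool}
    {es : ℕ → List (Ev X)}
    (h : ∀ i < n, LStep τ (rs i) (qs i) (es i) (Ls i) (Ls (i + 1))) :
    Chain τ (Ls 0) ((List.range n).flatMap es) (Ls n) := by
  induction n with
  | zero => exact .nil _
  | succ n ih =>
    rw [List.range_succ, List.flatMap_append]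
    refine (ih fun i hi => h i (by omega)).trans ?_
    simpa using Chain.step (h n (by omega))

theorem Chain.leaves_le_of_seq {n : ℕ} {Ls : ℕ → LF X} {rs : ℕ → RuleName}
    {qs : ℕ → List Bool} {es : ℕ → List (Ev X)}
    (h : ∀ i < n, LStep τ (rs i) (qs i) (es i) (Ls i) (Ls (i + 1))) {i : ℕ} (hi : i ≤ n) :
    (Ls i).leaves ≤ (Ls 0).leaves + (((List.range n).flatMap es).map Ev.los).sum := by
  obtain ⟨k, rfl⟩ := Nat.exists_eq_add_of_le hi
  have := (Chain.of_seq fun j hj => h j (by omega : j < i + k) : Chain τ (Ls 0)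
    ((List.range i).flatMap es) (Ls i)).conserve
  rw [List.range_add, List.flatMap_append, List.map_append, List.sum_append, ← add_assoc, this,
    add_assoc]
  exact Multiset.le_add_right _ _

theorem LRule.card_edges {r : RuleName} {ev : Ev X} {γ δ : LF X} (h : LRule τ r [ev] γ δ) :
    ev.los.card = (labDeg ev.lab).1 ∧ ev.ups.card = (labDeg ev.lab).2 := by
  cases h <;> simp [labDeg]

theorem LRule.polarity {r : RuleName} {ev : Ev X} {γ δ : LF X} (h : LRule τ r [ev] γ δ) :
    (ev.lab = .acDown ∨ ev.lab = .acUp →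
      ∀ x ∈ ev.los + ev.ups, ∀ y ∈ ev.los + ev.ups, (τ x).2 = (τ y).2) ∧
    (ev.lab = .aiDown ∨ ev.lab = .aiUp →
      ∃ x ∈ ev.los + ev.ups, ∃ y ∈ ev.los + ev.ups, (τ x).2 ≠ (τ y).2) := by
  cases h <;> simp_all [negAtom]

namespace Good

variable {A : PreFlow} {I O : Multiset ℕ}

theorem los_nodup {evs : Multiset (Ev ℕ)} (h : Good A I O evs) {ev : Ev ℕ} (he : ev ∈ evs) :
    ev.los.Nodup :=
  Multiset.nodup_of_le ((Multiset.le_sum_of_mem (Multiset.mem_map_of_mem _ he)).trans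
    (h.born ▸ Multiset.le_add_left _ _)) A.E.nodup

theorem Ledges_val {evs : Multiset (Ev ℕ)} (h : Good A I O evs) {ev : Ev ℕ} (he : ev ∈ evs) :
    (A.Ledges ev.v).val = ev.los := by
  refine (Multiset.Nodup.ext (Finset.nodup _) (h.los_nodup he)).2 fun x => ?_
  rw [Finset.mem_val, PreFlow.Ledges, Finset.mem_filter]
  exact ⟨fun hx => h.mem_los he hx.1 hx.2,
    fun hx => ⟨h.mem_E_of_los he hx, (h.ev _ he).2.1 _ hx⟩⟩

theorem Uedges_val {evs : Multiset (Ev ℕ)} (h : Good A I O evs) {ev : Ev ℕ} (he : ev ∈ evs) :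
    (A.Uedges ev.v).val = ev.ups :=
  h.flip.Ledges_val (Multiset.mem_map_of_mem Ev.flip he)

theorem exists_ev {evs : Multiset (Ev ℕ)} (h : Good A I O evs) {v : ℕ} (hv : v ∈ A.V) :
    ∃ ev ∈ evs, ev.v = v := by
  rw [← Finset.mem_val, ← h.verts] at hv
  exact Multiset.mem_map.1 hv

theorem v_mem {evs : Multiset (Ev ℕ)} (h : Good A I O evs) {ev : Ev ℕ} (he : ev ∈ evs) :
    ev.v ∈ A.V := by
  rw [← Finset.mem_val, ← h.verts]
  exact Multiset.mem_map_of_mem _ he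

theorem up_mem {evs : Multiset (Ev ℕ)} (h : Good A I O evs) {e v : ℕ} (he : e ∈ A.E)
    (hv : A.up e = some v) : v ∈ A.V := by
  rw [← Finset.mem_val, ← h.born, Multiset.mem_add, mem_sum_map] at he
  rcases he with he | ⟨ev, hev, he⟩
  · simp [h.top e he] at hv
  · rw [(h.ev _ hev).2.1 e he, Option.some_inj] at hv
    exact hv ▸ h.v_mem hev

theorem mem_edges {evs : Multiset (Ev ℕ)} (h : Good A I O evs) {ev : Ev ℕ} (he : ev ∈ evs)
    {x : ℕ} : x ∈ A.edges ev.v ↔ x ∈ ev.los + ev.ups := by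
  rw [PreFlow.edges, Finset.mem_union, Multiset.mem_add, ← h.Ledges_val he, ← h.Uedges_val he]
  rfl

variable {τ : ℕ → ℕ × Bool} {L L' : LF ℕ} {evs : List (Ev ℕ)}

theorem acyclic (h : Good A L.leaves L'.leaves evs) (c : Chain τ L evs L') : A.Acyclic := by
  rintro ⟨n, ε, hE, hε⟩
  have hn : (evs.map Ev.v).Nodup := by
    have := h.verts
    rw [Multiset.map_coe] at this
    rw [← Multiset.coe_nodup, this]
    exact A.V.nodup
  obtain ⟨i, hi⟩ := Finite.exists_min fun i => (evs.map Ev.v).idxOf ((A.up (ε i)).getD 0)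
  have hi := hi (i + 1)
  obtain ⟨v, hv⟩ := Option.isSome_iff_exists.1 (hε i).1
  obtain ⟨ev, hev, rfl⟩ := h.exists_ev (h.up_mem (hE i) hv)
  have hlo : A.lo (ε (i + 1)) = some ev.v := (hε i).2 ▸ hv
  have hu := h.mem_ups hev (hE (i + 1)) hlo
  obtain ⟨l₁, l₂, rfl⟩ := List.append_of_mem (Multiset.mem_coe.1 hev)
  rcases c.causal rfl hu with ht | ⟨ev', hev', hl⟩
  · simpa [h.top _ ht] using (hε (i + 1)).1
  · rw [hv, (h.ev ev' (by simp [hev'])).2.1 _ hl] at hi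
    rw [List.map_append, List.map_cons] at hn hi
    have hnot : ev.v ∉ l₁.map Ev.v := fun hm =>
      (List.nodup_append.1 hn).2.2 _ hm _ (List.mem_cons_self) rfl
    have hlt := List.idxOf_lt_length_of_mem (List.mem_map_of_mem (f := Ev.v) hev')
    simp only [Option.getD_some] at hi
    rw [List.idxOf_append_of_notMem hnot,
      List.idxOf_append_of_mem (List.mem_map_of_mem hev')] at hi
    omega

theorem isFlow (h : Good A L.leaves L'.leaves evs) (c : Chain τ L evs L') : A.IsFlow := by
  refine ⟨fun v hv => ?_, fun e he => ⟨fun v hv => h.up_mem he hv,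
    fun v hv => h.flip.up_mem (A := A.flip) he hv⟩, h.acyclic c, fun e => (τ e).2, fun v hv => ?_⟩
  · obtain ⟨ev, hev, rfl⟩ := h.exists_ev hv
    obtain ⟨r, γ, δ, hr⟩ := c.exists_rule hev
    rw [Finset.card, Finset.card, h.Ledges_val hev, h.Uedges_val hev, (h.ev ev hev).1]
    exact hr.card_edges
  · obtain ⟨ev, hev, rfl⟩ := h.exists_ev hv
    obtain ⟨r, γ, δ, hr⟩ := c.exists_rule hev
    simp only [h.mem_edges hev, (h.ev ev hev).1]
    exact hr.polarity

end Good

theorem Realizes.exists_isAssocFlow {A : PreFlow} {φ ψ : Formula} (h : Realizes A φ ψ) :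
    ∃ (Ψ : Deriv) (f : ℕ → List Bool → ℕ) (g : ℕ → ℕ),
      IsAssocFlow Ψ A f g ∧ Ψ.prem = φ ∧ Ψ.concl = ψ := by
  obtain ⟨τ, L, L', evs, c, h, rfl, rfl⟩ := h
  obtain ⟨n, Ls, rs, qs, es, rfl, rfl, hs, rfl⟩ := c.exists_seq
  obtain ⟨Ψ, hΨ⟩ : ∃ Ψ : Deriv, Ψ = ⟨(Ls 0).erase τ,
    (List.range n).map fun i => (rs i, qs i, (Ls (i + 1)).erase τ)⟩ := ⟨_, rfl⟩
  have hlen : Ψ.steps.length = n := by simp [hΨ]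
  have hfml : ∀ i ≤ n, Ψ.fml i = (Ls i).erase τ := by
    rintro (_ | i) hi
    · simp [hΨ, Deriv.fml]
    · have hi : i < n := hi
      simp [hΨ, Deriv.fml, hi]
  have hstep : ∀ i < n, Ψ.stepAt i = (rs i, qs i, (Ls (i + 1)).erase τ) := by
    intro i hi
    simp [hΨ, Deriv.stepAt, hi]
  have hle : ∀ i ≤ n, (Ls i).leaves ≤ A.E.val := by
    intro i hi
    refine (Chain.leaves_le_of_seq hs hi).trans_eq ?_
    rw [← h.born, Multiset.map_coe, Multiset.sum_coe]
  have hnodup : ∀ i ≤ n, (Ls i).leaves.Nodup := fun i hi =>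
    Multiset.nodup_of_le (hle i hi) A.E.nodup
  have hmem : ∀ i < n, ∀ ev ∈ es i, ev ∈ (List.range n).flatMap es := fun i hi ev hev =>
    List.mem_flatMap.2 ⟨i, List.mem_range.2 hi, hev⟩
  have hes : ∀ i < n, ((rs i).isStructural = false ∧ es i = []) ∨
      ((rs i).isStructural = true ∧ ∃ ev, es i = [ev]) := by
    intro i hi
    obtain ⟨γ, δ, hr⟩ := (hs i hi).exists_rule
    exact hr.events
  have hstr : ∀ i < n, (rs i).isStructural = true → ∃ ev, es i = [ev] := by
    intro i hi hr
    rcases hes i hi with ⟨h, -⟩ | ⟨-, h⟩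
    · simp [h] at hr
    · exact h
  refine ⟨Ψ, fun i => (Ls i).labAt 0, fun i => ((es i).map Ev.v).headD 0,
    ⟨?_, h.isFlow c, ?_, ?_, ?_, ?_, ?_, ?_, ?_, ?_, ?_⟩, by rw [hΨ], by
      rw [Deriv.concl, hlen, hfml n le_rfl]⟩
  · intro i hi
    rw [hlen] at hi
    rw [hstep i hi, hfml i hi.le, hfml (i + 1) hi]
    exact (hs i hi).stepAt
  · intro i p hi hp
    have hi : i ≤ n := by rw [Deriv.nf, hlen] at hi; omega
    rw [hfml i hi] at hp
    exact Multiset.mem_of_le (hle i hi) (LF.labAt_mem hp)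
  · intro e he
    rw [← Finset.mem_val, ← h.born, Multiset.mem_add, mem_sum_map] at he
    obtain ⟨i, hi, hl⟩ : ∃ i, i ≤ n ∧ e ∈ (Ls i).leaves := by
      rcases he with he | ⟨ev, hev, he⟩
      · exact ⟨0, Nat.zero_le _, he⟩
      · obtain ⟨i, hi, hev⟩ := List.mem_flatMap.1 hev
        rw [List.mem_range] at hi
        refine ⟨i + 1, hi, Multiset.mem_of_le (hs i hi).conserve.2.2 ?_⟩
        rw [← Multiset.sum_coe, ← Multiset.map_coe]
        exact mem_sum_map.2 ⟨ev, hev, he⟩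
    obtain ⟨p, hp, hpe⟩ := LF.exists_labAt τ 0 hl
    exact ⟨i, p, by rw [Deriv.nf, hlen]; omega, by rwa [hfml i hi], hpe⟩
  · intro i p p' hi hp hp' he
    have hi : i ≤ n := by rw [Deriv.nf, hlen] at hi; omega
    rw [hfml i hi] at hp hp'
    exact LF.labAt_inj (hnodup i hi) hp hp' he
  · intro p hp
    rw [hfml 0 (Nat.zero_le _)] at hp
    exact h.top _ (LF.labAt_mem hp)
  · intro p hp
    rw [hlen, hfml n le_rfl] at hp
    simp only [hlen]
    exact h.bot _ (LF.labAt_mem hp)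
  · intro i hi hr
    rw [hlen] at hi
    rw [hstep i hi] at hr
    obtain ⟨ev, he⟩ := hstr i hi hr
    simpa [he] using h.v_mem (Multiset.mem_coe.2 (hmem i hi ev (by simp [he])))
  · intro v hv
    obtain ⟨ev, hev, rfl⟩ := h.exists_ev hv
    obtain ⟨i, hi, hev⟩ := List.mem_flatMap.1 hev
    rw [List.mem_range] at hi
    refine ⟨i, by omega, ?_⟩
    rw [hstep i hi]
    rcases hes i hi with ⟨-, h⟩ | ⟨hr, ev', h⟩
    · simp [h] at hev
    · obtain rfl : ev = ev' := by simpa [h] using hev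
      exact ⟨hr, by simp [h]⟩
  · intro i j hi hj hri hrj hg
    rw [hlen] at hi hj
    rw [hstep i hi] at hri
    rw [hstep j hj] at hrj
    obtain ⟨ev, he⟩ := hstr i hi hri
    obtain ⟨ev', he'⟩ := hstr j hj hrj
    have hv : (((List.range n).flatMap es).map Ev.v).Nodup := by
      have := h.verts
      rw [Multiset.map_coe] at this
      rw [← Multiset.coe_nodup, this]
      exact A.V.nodup
    rw [List.map_flatMap, List.nodup_flatMap] at hv
    have key : ∀ i j, i < j → j < n → ∀ ev ∈ es i, ∀ ev' ∈ es j, ev.v ≠ ev'.v := by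
      intro i j hij hj ev hev ev' hev' h
      have := List.pairwise_iff_getElem.1 hv.2 i j (by simp; omega) (by simpa) hij
      simp only [List.getElem_range] at this
      exact this (List.mem_map_of_mem hev) (h ▸ List.mem_map_of_mem hev')
    have hvv : ev.v = ev'.v := by simpa [he, he'] using hg
    rcases lt_trichotomy i j with hij | hij | hij
    · exact absurd hvv (key i j hij hj ev (by simp [he]) ev' (by simp [he']))
    · exact hij
    · exact absurd hvv.symm (key j i hij hi ev' (by simp [he']) ev (by simp [he]))
  · intro i hi
    rw [hlen] at hi
    rw [stepCond_iff, hstep i hi, hfml i hi.le, hfml (i + 1) hi]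
    refine (hs i hi).stepRel (hnodup i hi.le) (hnodup (i + 1) hi) fun ev hev => ?_
    have hev' : ((es i).map Ev.v).headD 0 = ev.v := by
      rcases hes i hi with ⟨-, h⟩ | ⟨hr, ev', h⟩
      · simp [h] at hev
      · obtain rfl : ev = ev' := by simpa [h] using hev
        simp [h]
    simp only [hev', true_and]
    exact h.ev ev (Multiset.mem_coe.2 (hmem i hi ev hev))

/-! ### From derivations to labelled derivations. -/

/-- Label the atom occurrences of a formula by their atoms and by edges. -/
def Formula.label : Formula → (List Bool → ℕ) → LF ((ℕ × Bool) × ℕ)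
  | .tt, _ => .tt
  | .ff, _ => .ff
  | .atom n b, F => .atm ((n, b), F [])
  | .or α β, F => .or (label α fun p => F (false :: p)) (label β fun p => F (true :: p))
  | .and α β, F => .and (label α fun p => F (false :: p)) (label β fun p => F (true :: p))

namespace Formula

variable {φ : Formula} {F F' : List Bool → ℕ}

theorem erase_label (φ : Formula) (F : List Bool → ℕ) : (φ.label F).erase Prod.fst = φ := by
  induction φ generalizing F <;> simp_all [label, LF.erase]

theorem label_congr (h : ∀ p, φ.IsOcc p → F p = F' p) : φ.label F = φ.label F' := by
  induction φ generalizing F F' with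
  | tt => rfl
  | ff => rfl
  | atom n b => simp only [label, h [] (isOcc_atom.2 rfl)]
  | or α β iα iβ =>
    simp only [label]
    rw [iα fun p hp => h (false :: p) hp, iβ fun p hp => h (true :: p) hp]
  | and α β iα iβ =>
    simp only [label]
    rw [iα fun p hp => h (false :: p) hp, iβ fun p hp => h (true :: p) hp]

theorem mem_label {e : ℕ} :
    e ∈ (φ.label F).leaves.map Prod.snd ↔ ∃ p, φ.IsOcc p ∧ F p = e := by
  induction φ generalizing F with
  | tt => simp [label, LF.leaves, not_isOcc_tt]
  | ff => simp [label, LF.leaves, not_isOcc_ff]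
  | atom n b => simp [label, LF.leaves, isOcc_atom, eq_comm]
  | or α β iα iβ =>
    simp only [label, LF.leaves, Multiset.map_add, Multiset.mem_add, iα, iβ, isOcc_or]
    constructor
    · rintro (⟨p, hp, rfl⟩ | ⟨p, hp, rfl⟩)
      · exact ⟨_, .inl ⟨p, rfl, hp⟩, rfl⟩
      · exact ⟨_, .inr ⟨p, rfl, hp⟩, rfl⟩
    · rintro ⟨_, ⟨p, rfl, hp⟩ | ⟨p, rfl, hp⟩, rfl⟩
      · exact .inl ⟨p, hp, rfl⟩
      · exact .inr ⟨p, hp, rfl⟩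
  | and α β iα iβ =>
    simp only [label, LF.leaves, Multiset.map_add, Multiset.mem_add, iα, iβ, isOcc_and]
    constructor
    · rintro (⟨p, hp, rfl⟩ | ⟨p, hp, rfl⟩)
      · exact ⟨_, .inl ⟨p, rfl, hp⟩, rfl⟩
      · exact ⟨_, .inr ⟨p, rfl, hp⟩, rfl⟩
    · rintro ⟨_, ⟨p, rfl, hp⟩ | ⟨p, rfl, hp⟩, rfl⟩
      · exact .inl ⟨p, hp, rfl⟩
      · exact .inr ⟨p, hp, rfl⟩

theorem nodup_label (h : ∀ p p', φ.IsOcc p → φ.IsOcc p' → F p = F p' → p = p') :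
    ((φ.label F).leaves.map Prod.snd).Nodup := by
  induction φ generalizing F with
  | tt => simp [label, LF.leaves]
  | ff => simp [label, LF.leaves]
  | atom n b => simp [label, LF.leaves]
  | or α β iα iβ =>
    simp only [label, LF.leaves, Multiset.map_add]
    refine Multiset.nodup_add.2 ⟨iα fun p p' hp hp' he => ?_, iβ fun p p' hp hp' he => ?_,
      Multiset.disjoint_left.2 fun {e} he he' => ?_⟩
    · exact (List.cons.inj (h (false :: p) (false :: p') hp hp' he)).2
    · exact (List.cons.inj (h (true :: p) (true :: p') hp hp' he)).2
    · obtain ⟨p, hp, rfl⟩ := mem_label.1 he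
      obtain ⟨p', hp', he⟩ := mem_label.1 he'
      simpa using (List.cons.inj (h (true :: p') (false :: p) hp' hp he)).1
  | and α β iα iβ =>
    simp only [label, LF.leaves, Multiset.map_add]
    refine Multiset.nodup_add.2 ⟨iα fun p p' hp hp' he => ?_, iβ fun p p' hp hp' he => ?_,
      Multiset.disjoint_left.2 fun {e} he he' => ?_⟩
    · exact (List.cons.inj (h (false :: p) (false :: p') hp hp' he)).2
    · exact (List.cons.inj (h (true :: p) (true :: p') hp hp' he)).2
    · obtain ⟨p, hp, rfl⟩ := mem_label.1 he
      obtain ⟨p', hp', he⟩ := mem_label.1 he'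
      simpa using (List.cons.inj (h (true :: p') (false :: p) hp' hp he)).1

end Formula

/-- The events `es` come from the vertex `v` of the flow `A`. -/
def EventsAt (A : PreFlow) (v : ℕ) (es : List (Ev ((ℕ × Bool) × ℕ))) : Prop :=
  ∀ ev ∈ es, ev.v = v ∧ A.η v = ev.lab ∧ (∀ x ∈ ev.los, A.up x.2 = some v) ∧
    ∀ x ∈ ev.ups, A.lo x.2 = some v

theorem RuleInstance.exists_lrule {A : PreFlow} {v : ℕ} {r : RuleName} {φ ψ : Formula}
    {F F' : List Bool → ℕ} (hr : RuleInstance r φ ψ) (h : stepRel A v r [] φ ψ F F') :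
    ∃ es, LRule Prod.fst r es (φ.label F) (ψ.label F') ∧ EventsAt A v es := by
  replace h := h.2
  cases hr with
  | aiDown n b =>
    exact ⟨_, .aiDown v _ _ rfl, by simpa [EventsAt, -Prod.forall] using ⟨h.1, h.2.1, h.2.2.1⟩⟩
  | aiUp n b =>
    exact ⟨_, .aiUp v _ _ rfl, by simpa [EventsAt, -Prod.forall] using ⟨h.1, h.2.1, h.2.2.1⟩⟩
  | awDown n b => exact ⟨_, .awDown v _, by simpa [EventsAt, -Prod.forall] using h⟩
  | awUp n b => exact ⟨_, .awUp v _, by simpa [EventsAt, -Prod.forall] using h⟩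
  | acDown n b =>
    exact ⟨_, .acDown v _ _ _ rfl rfl,
      by simpa [EventsAt, -Prod.forall] using ⟨h.1, h.2.2.2.1, h.2.1, h.2.2.1⟩⟩
  | acUp n b =>
    exact ⟨_, .acUp v _ _ _ rfl rfl,
      by simpa [EventsAt, -Prod.forall] using ⟨h.1, ⟨h.2.2.1, h.2.2.2.1⟩, h.2.1⟩⟩
  | s α β γ =>
    simp [corrCond] at h
    refine ⟨[], ?_, by simp [EventsAt]⟩
    simp only [Formula.label]
    rw [Formula.label_congr (φ := α) h.1, Formula.label_congr (φ := β) h.2.1,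
      Formula.label_congr (φ := γ) h.2.2]
    constructor
  | m α β γ δ =>
    simp [corrCond] at h
    refine ⟨[], ?_, by simp [EventsAt]⟩
    simp only [Formula.label]
    rw [Formula.label_congr (φ := α) h.1, Formula.label_congr (φ := β) h.2.1,
      Formula.label_congr (φ := γ) h.2.2.1, Formula.label_congr (φ := δ) h.2.2.2]
    constructor
  | eqOrComm α β =>
    simp [corrCond] at h
    refine ⟨[], ?_, by simp [EventsAt]⟩
    simp only [Formula.label]
    rw [Formula.label_congr (φ := β) h.1, Formula.label_congr (φ := α) h.2]
    constructor
  | eqAndComm α β =>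
    simp [corrCond] at h
    refine ⟨[], ?_, by simp [EventsAt]⟩
    simp only [Formula.label]
    rw [Formula.label_congr (φ := β) h.1, Formula.label_congr (φ := α) h.2]
    constructor
  | eqOrAssocL α β γ =>
    simp [corrCond] at h
    refine ⟨[], ?_, by simp [EventsAt]⟩
    simp only [Formula.label]
    rw [Formula.label_congr (φ := α) h.1, Formula.label_congr (φ := β) h.2.1,
      Formula.label_congr (φ := γ) h.2.2]
    constructor
  | eqOrAssocR α β γ =>
    simp [corrCond] at h
    refine ⟨[], ?_, by simp [EventsAt]⟩
    simp only [Formula.label]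
    rw [Formula.label_congr (φ := α) h.1, Formula.label_congr (φ := β) h.2.1,
      Formula.label_congr (φ := γ) h.2.2]
    constructor
  | eqAndAssocL α β γ =>
    simp [corrCond] at h
    refine ⟨[], ?_, by simp [EventsAt]⟩
    simp only [Formula.label]
    rw [Formula.label_congr (φ := α) h.1, Formula.label_congr (φ := β) h.2.1,
      Formula.label_congr (φ := γ) h.2.2]
    constructor
  | eqAndAssocR α β γ =>
    simp [corrCond] at h
    refine ⟨[], ?_, by simp [EventsAt]⟩
    simp only [Formula.label]
    rw [Formula.label_congr (φ := α) h.1, Formula.label_congr (φ := β) h.2.1,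
      Formula.label_congr (φ := γ) h.2.2]
    constructor
  | eqOrUnitDel =>
    simp [corrCond] at h
    refine ⟨[], ?_, by simp [EventsAt]⟩
    simp only [Formula.label]
    rw [Formula.label_congr (φ := ψ) h]
    constructor
  | eqOrUnitAdd =>
    simp [corrCond] at h
    refine ⟨[], ?_, by simp [EventsAt]⟩
    simp only [Formula.label]
    rw [Formula.label_congr (φ := φ) h]
    constructor
  | eqAndUnitDel =>
    simp [corrCond] at h
    refine ⟨[], ?_, by simp [EventsAt]⟩
    simp only [Formula.label]
    rw [Formula.label_congr (φ := ψ) h]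
    constructor
  | eqAndUnitAdd =>
    simp [corrCond] at h
    refine ⟨[], ?_, by simp [EventsAt]⟩
    simp only [Formula.label]
    rw [Formula.label_congr (φ := φ) h]
    constructor
  | eqTTDel =>
    exact ⟨[], .eqTTDel, by simp [EventsAt]⟩
  | eqTTAdd =>
    exact ⟨[], .eqTTAdd, by simp [EventsAt]⟩
  | eqFFDel =>
    exact ⟨[], .eqFFDel, by simp [EventsAt]⟩
  | eqFFAdd =>
    exact ⟨[], .eqFFAdd, by simp [EventsAt]⟩

theorem StepAt.exists_lstep {A : PreFlow} {v : ℕ} {r : RuleName} {q : List Bool}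
    {φ ψ : Formula} {F F' : List Bool → ℕ} (hs : StepAt r q φ ψ)
    (h : stepRel A v r q φ ψ F F') :
    ∃ es, LStep Prod.fst r q es (φ.label F) (ψ.label F') ∧ EventsAt A v es := by
  obtain ⟨γ, δ, hγ, hr, rfl⟩ := hs
  induction q generalizing φ F F' with
  | nil =>
    rw [Formula.sub_nil, Option.some_inj] at hγ
    subst hγ
    rw [Formula.repl_nil] at h ⊢
    obtain ⟨es, he, hv⟩ := hr.exists_lrule h
    exact ⟨es, .base he, hv⟩
  | cons b q ih =>
    cases φ with
    | tt => simp [Formula.sub] at hγ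
    | ff => simp [Formula.sub] at hγ
    | atom n c => simp [Formula.sub] at hγ
    | or α β =>
      cases b with
      | false =>
        obtain ⟨h₁, h₂⟩ := (stepRel_cons (φ := α) (ψ := α.repl q δ)
          (fun p => Iff.rfl) fun p => Iff.rfl).1 h
        obtain ⟨es, he, hv⟩ := ih hγ h₂
        refine ⟨es, ?_, hv⟩
        simp only [Formula.repl, Formula.label]
        rw [Formula.label_congr (φ := β) fun p hp => h₁ (true :: p) (by simp) hp]
        exact .orL _ he
      | true =>
        obtain ⟨h₁, h₂⟩ := (stepRel_cons (φ := β) (ψ := β.repl q δ)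
          (fun p => Iff.rfl) fun p => Iff.rfl).1 h
        obtain ⟨es, he, hv⟩ := ih hγ h₂
        refine ⟨es, ?_, hv⟩
        simp only [Formula.repl, Formula.label]
        rw [Formula.label_congr (φ := α) fun p hp => h₁ (false :: p) (by simp) hp]
        exact .orR _ he
    | and α β =>
      cases b with
      | false =>
        obtain ⟨h₁, h₂⟩ := (stepRel_cons (φ := α) (ψ := α.repl q δ)
          (fun p => Iff.rfl) fun p => Iff.rfl).1 h
        obtain ⟨es, he, hv⟩ := ih hγ h₂
        refine ⟨es, ?_, hv⟩
        simp only [Formula.repl, Formula.label]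
        rw [Formula.label_congr (φ := β) fun p hp => h₁ (true :: p) (by simp) hp]
        exact .andL _ he
      | true =>
        obtain ⟨h₁, h₂⟩ := (stepRel_cons (φ := β) (ψ := β.repl q δ)
          (fun p => Iff.rfl) fun p => Iff.rfl).1 h
        obtain ⟨es, he, hv⟩ := ih hγ h₂
        refine ⟨es, ?_, hv⟩
        simp only [Formula.repl, Formula.label]
        rw [Formula.label_congr (φ := α) fun p hp => h₁ (false :: p) (by simp) hp]
        exact .andR _ he

theorem nodup_sum_los {up : X → Option ℕ} {evs : List (Ev X)} (hv : (evs.map Ev.v).Nodup)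
    (h : ∀ ev ∈ evs, ev.los.Nodup ∧ ∀ x ∈ ev.los, up x = some ev.v) :
    (evs.map Ev.los).sum.Nodup := by
  induction evs with
  | nil => simp
  | cons ev evs ih =>
    rw [List.map_cons, List.nodup_cons] at hv
    rw [List.map_cons, List.sum_cons]
    refine Multiset.nodup_add.2 ⟨(h ev (by simp)).1, ih hv.2 fun ev' h' => h ev' (by simp [h']),
      Multiset.disjoint_left.2 fun {x} hx hx' => hv.1 ?_⟩
    rw [← Multiset.sum_coe, ← Multiset.map_coe, mem_sum_map] at hx'
    obtain ⟨ev', h', hx'⟩ := hx'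
    have := ((h ev (by simp)).2 x hx).symm.trans ((h ev' (List.mem_cons_of_mem _ h')).2 x hx')
    rw [Option.some_inj.1 this]
    exact List.mem_map_of_mem h'

theorem exists_retraction {Y : Type} [Inhabited X] {N : Multiset (X × Y)}
    (h : (N.map Prod.snd).Nodup) : ∃ τ : Y → X, ∀ x ∈ N, τ x.2 = x.1 := by
  have : ∀ y : Y, ∃ a : X, ∀ x ∈ N, x.2 = y → a = x.1 := by
    intro y
    by_cases hy : ∃ x ∈ N, x.2 = y
    · obtain ⟨x, hx, rfl⟩ := hy
      exact ⟨x.1, fun x' hx' he => by rw [Multiset.inj_on_of_nodup_map h x' hx' x hx he]⟩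
    · exact ⟨default, fun x hx he => absurd ⟨x, hx, he⟩ hy⟩
  choose τ hτ using this
  exact ⟨τ, fun x hx => hτ _ x hx rfl⟩

/-- The underlying edges of a labelled derivation on labels carrying their atoms. -/
theorem Chain.realizes {A : PreFlow} {L L' : LF ((ℕ × Bool) × ℕ)}
    {evs : List (Ev ((ℕ × Bool) × ℕ))} (c : Chain Prod.fst L evs L')
    (h : Good A (L.leaves.map Prod.snd) (L'.leaves.map Prod.snd)
      ((evs.map (Ev.map Prod.snd) : List (Ev ℕ)))) :
    Realizes A (L.erase Prod.fst) (L'.erase Prod.fst) := by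
  have hN : ((L.leaves + (evs.map Ev.los).sum).map Prod.snd).Nodup := by
    have hb := h.born
    rw [Multiset.map_coe, List.map_map] at hb
    have : (evs.map Ev.los).sum.map Prod.snd =
        ((evs.map (Ev.los ∘ Ev.map Prod.snd) : List (Multiset ℕ)) : Multiset _).sum := by
      rw [← Multiset.sum_coe, ← Multiset.map_coe, ← sum_map_map, ← Multiset.map_coe]
      rfl
    rw [Multiset.map_add, this, hb]
    exact A.E.nodup
  obtain ⟨τ', hτ⟩ := exists_retraction hN
  have hlos : ∀ ev ∈ evs, ∀ x ∈ ev.los, τ' x.2 = x.1 := fun ev hev x hx =>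
    hτ x (Multiset.mem_add.2 (.inr (by
      rw [← Multiset.sum_coe, ← Multiset.map_coe]; exact mem_sum_map.2 ⟨ev, hev, hx⟩)))
  rw [c.conserve] at hτ
  have hups : ∀ ev ∈ evs, ∀ x ∈ ev.ups, τ' x.2 = x.1 := fun ev hev x hx =>
    hτ x (Multiset.mem_add.2 (.inr (by
      rw [← Multiset.sum_coe, ← Multiset.map_coe]; exact mem_sum_map.2 ⟨ev, hev, hx⟩)))
  have hL' : ∀ x ∈ L'.leaves, τ' x.2 = x.1 := fun x hx => hτ x (Multiset.mem_add.2 (.inl hx))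
  rw [← c.conserve] at hτ
  have hL : ∀ x ∈ L.leaves, τ' x.2 = x.1 := fun x hx => hτ x (Multiset.mem_add.2 (.inl hx))
  refine ⟨τ', L.bind fun x => .atm x.2, L'.bind fun x => .atm x.2, evs.map (Ev.map Prod.snd),
    ?_, ?_, LF.erase_bind_atm (ρ := Prod.snd) L hL,
    LF.erase_bind_atm (ρ := Prod.snd) L' hL'⟩
  · rw [List.map_eq_flatMap]
    refine c.sim fun ev hev r γ δ hr => .rule (hr.bind_atm fun x hx => ⟨rfl, ?_⟩)
    exact (Multiset.mem_add.1 hx).elim (hups ev hev x) (hlos ev hev x)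
  · rwa [LF.leaves_bind_atm, LF.leaves_bind_atm]

theorem IsAssocFlow.realizes {Φ : Deriv} {A : PreFlow} {f : ℕ → List Bool → ℕ} {g : ℕ → ℕ}
    (h : IsAssocFlow Φ A f g) : Realizes A Φ.prem Φ.concl := by
  obtain ⟨hwf, -, hE, hsurj, hinj, htop, hbot, hgV, hgsurj, hginj, hstep⟩ := h
  obtain ⟨n, hn⟩ : ∃ n, Φ.steps.length = n := ⟨_, rfl⟩
  simp only [Deriv.nf, Deriv.WF, hn, Nat.lt_succ_iff] at hwf hE hsurj hinj hbot hgV hgsurj hginj hstep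
  have hex : ∀ i, ∃ es, i < n → LStep Prod.fst (Φ.stepAt i).1 (Φ.stepAt i).2.1 es
      ((Φ.fml i).label (f i)) ((Φ.fml (i + 1)).label (f (i + 1))) ∧ EventsAt A (g i) es := by
    intro i
    by_cases hi : i < n
    · obtain ⟨es, he⟩ := (hwf i hi).exists_lstep (stepCond_iff.1 (hstep i hi))
      exact ⟨es, fun _ => he⟩
    · exact ⟨[], fun h => absurd h hi⟩
  choose es hes using hex
  have hs := fun i hi => (hes i hi).1
  have c := Chain.of_seq (Ls := fun i => (Φ.fml i).label (f i)) hs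
  have hev : ∀ i < n, ((Φ.stepAt i).1.isStructural = false ∧ es i = []) ∨
      ((Φ.stepAt i).1.isStructural = true ∧ ∃ ev, es i = [ev] ∧ ev.v = g i) := by
    intro i hi
    obtain ⟨γ, δ, hr⟩ := (hs i hi).exists_rule
    rcases hr.events with h | ⟨h, ev, he⟩
    · exact .inl h
    · exact .inr ⟨h, ev, he, ((hes i hi).2 ev (by simp [he])).1⟩
  have hmem : ∀ i < n, ∀ ev ∈ es i, (Φ.stepAt i).1.isStructural = true := by
    intro i hi ev he
    rcases hev i hi with ⟨-, h⟩ | ⟨h, -⟩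
    · simp [h] at he
    · exact h
  have hv : (((List.range n).flatMap es).map Ev.v).Nodup := by
    rw [List.map_flatMap, List.nodup_flatMap]
    refine ⟨fun i hi => ?_, List.nodup_range.pairwise_of_forall_ne fun i hi j hj hij => ?_⟩
    · rcases hev i (List.mem_range.1 hi) with ⟨-, h⟩ | ⟨-, ev, h, -⟩ <;> simp [h]
    · rw [List.mem_range] at hi hj
      intro v hvi hvj
      obtain ⟨ev, he, rfl⟩ := List.mem_map.1 hvi
      obtain ⟨ev', he', hv⟩ := List.mem_map.1 hvj
      rw [((hes i hi).2 ev he).1, ((hes j hj).2 ev' he').1] at hv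
      exact hij (hginj i j hi hj (hmem i hi ev he) (hmem j hj ev' he') hv.symm)
  have hlos : ∀ i < n, ∀ ev ∈ es i, ev.los ≤ ((Φ.fml (i + 1)).label (f (i + 1))).leaves := by
    intro i hi ev he
    refine le_trans ?_ (hs i hi).conserve.2.2
    rw [← Multiset.sum_coe, ← Multiset.map_coe]
    exact Multiset.le_sum_of_mem (Multiset.mem_map_of_mem _ he)
  have hfE : ∀ i ≤ n, ∀ e ∈ ((Φ.fml i).label (f i)).leaves.map Prod.snd, e ∈ A.E := by
    intro i hi e he
    obtain ⟨p, hp, rfl⟩ := Formula.mem_label.1 he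
    exact hE i p hi hp
  have hsum : ∀ F : ∀ {X : Type}, Ev X → Multiset X,
      (∀ ev : Ev ((ℕ × Bool) × ℕ), F (ev.map Prod.snd) = (F ev).map Prod.snd) →
      ((((List.range n).flatMap es).map (Ev.map Prod.snd)).map F).sum =
        (((List.range n).flatMap es).map F).sum.map Prod.snd := by
    intro F hF
    rw [List.map_map, ← Multiset.sum_coe, ← Multiset.map_coe, ← Multiset.sum_coe,
      ← Multiset.map_coe, ← sum_map_map]
    exact congrArg Multiset.sum (Multiset.map_congr rfl fun ev _ => hF ev)
  have hmap : (((List.range n).flatMap es).map (Ev.map Prod.snd)).map Ev.v =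
      ((List.range n).flatMap es).map Ev.v := by rw [List.map_map]; rfl
  have hEv : ∀ ev ∈ ((List.range n).flatMap es).map (Ev.map Prod.snd),
      ev.los.Nodup ∧ ∀ x ∈ ev.los, x ∈ A.E ∧ A.up x = some ev.v := by
    intro _ h
    obtain ⟨ev, hev, rfl⟩ := List.mem_map.1 h
    obtain ⟨i, hi, h⟩ := List.mem_flatMap.1 hev
    rw [List.mem_range] at hi
    have hle := Multiset.map_le_map (f := Prod.snd) (hlos i hi ev h)
    refine ⟨Multiset.nodup_of_le hle (Formula.nodup_label fun p p' => hinj (i + 1) p p' hi),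
      fun x hx => ⟨hfE (i + 1) hi x (Multiset.mem_of_le hle hx), ?_⟩⟩
    obtain ⟨x, hx', rfl⟩ := Multiset.mem_map.1 hx
    have := (hes i hi).2 ev h
    rw [this.2.2.1 x hx']
    exact congrArg some this.1.symm
  have hborn : ((Φ.fml 0).label (f 0)).leaves.map Prod.snd +
      ((((List.range n).flatMap es).map (Ev.map Prod.snd)).map Ev.los).sum = A.E.val := by
    refine (Multiset.Nodup.ext (Multiset.nodup_add.2
      ⟨Formula.nodup_label fun p p' => hinj 0 p p' (Nat.zero_le n),
        nodup_sum_los (hmap ▸ hv) fun ev h => ⟨(hEv ev h).1, fun x hx => ((hEv ev h).2 x hx).2⟩,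
        Multiset.disjoint_left.2 fun {x} hx hx' => ?_⟩) A.E.nodup).2 fun e => ⟨fun he => ?_,
      fun he => ?_⟩
    · obtain ⟨p, hp, rfl⟩ := Formula.mem_label.1 hx
      rw [← Multiset.sum_coe, ← Multiset.map_coe, mem_sum_map] at hx'
      obtain ⟨ev, h, hx'⟩ := hx'
      simpa [htop p hp] using ((hEv ev h).2 _ hx').2
    · rcases Multiset.mem_add.1 he with he | he
      · exact hfE 0 (Nat.zero_le n) e he
      · rw [← Multiset.sum_coe, ← Multiset.map_coe, mem_sum_map] at he
        obtain ⟨ev, h, he⟩ := he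
        exact ((hEv ev h).2 e he).1
    · obtain ⟨i, p, hi, hp, rfl⟩ := hsurj e he
      rw [hsum Ev.los fun _ => rfl, ← Multiset.map_add]
      exact Multiset.mem_of_le (Multiset.map_le_map
        (Chain.leaves_le_of_seq (Ls := fun i => (Φ.fml i).label (f i)) hs hi))
        (Formula.mem_label.2 ⟨p, hp, rfl⟩)
  have := c.realizes (A := A) ⟨?_, ?_, ?_, ?_, ?_, ?_⟩
  · simp only [Formula.erase_label] at this
    rw [Deriv.concl, hn]
    exact this
  · rw [Multiset.map_coe, hmap]
    refine (Multiset.Nodup.ext (Multiset.coe_nodup.2 hv) A.V.nodup).2 fun v => ⟨fun h => ?_,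
      fun h => ?_⟩
    · obtain ⟨ev, hev, rfl⟩ := List.mem_map.1 (Multiset.mem_coe.1 h)
      obtain ⟨i, hi, h⟩ := List.mem_flatMap.1 hev
      rw [List.mem_range] at hi
      rw [((hes i hi).2 ev h).1]
      exact hgV i hi (hmem i hi ev h)
    · obtain ⟨i, hi, h, rfl⟩ := hgsurj v h
      rcases hev i hi with ⟨h', -⟩ | ⟨-, ev, he, hg⟩
      · simp_all
      · exact Multiset.mem_coe.2 (List.mem_map.2 ⟨ev, List.mem_flatMap.2
          ⟨i, List.mem_range.2 hi, by simp [he]⟩, hg⟩)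
  · rwa [Multiset.map_coe, Multiset.sum_coe]
  · rw [← hborn, Multiset.map_coe, Multiset.sum_coe, hsum Ev.ups fun _ => rfl,
      hsum Ev.los fun _ => rfl, ← Multiset.map_add, ← Multiset.map_add, c.conserve]
  · intro e he
    obtain ⟨p, hp, rfl⟩ := Formula.mem_label.1 he
    exact htop p hp
  · intro e he
    obtain ⟨p, hp, rfl⟩ := Formula.mem_label.1 he
    exact hbot p hp
  · intro ev h
    obtain ⟨ev, hev, rfl⟩ := List.mem_map.1 (Multiset.mem_coe.1 h)
    obtain ⟨i, hi, h⟩ := List.mem_flatMap.1 hev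
    obtain ⟨hg, hl, hlo, hup⟩ := (hes i (List.mem_range.1 hi)).2 ev h
    refine ⟨(congrArg A.η hg).trans hl, fun e he => ?_, fun e he => ?_⟩ <;>
      obtain ⟨x, hx, rfl⟩ := Multiset.mem_map.1 he
    · rw [hlo x hx, ← hg]; rfl
    · rw [hup x hx, ← hg]; rfl

/-- Each of the ten local atomic-flow reduction rules is
sound: if `A` reduces to `B` by one of them and `Φ` is an SKS derivation
whose associated atomic flow is `A`, then there is an SKS derivation `Ψ`
whose associated atomic flow is `B` and whose premiss and conclusion are the
same as those of `Φ`. -/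
theorem statement_6 (A B : PreFlow)
    (hred : RedWdCd A B ∨ RedCuWu A B ∨ RedWdIu A B ∨ RedIdWu A B ∨
            RedWdWu A B ∨ RedWdCu A B ∨ RedCdWu A B ∨
            RedCdIu A B ∨ RedIdCu A B ∨ RedCdCu A B)
    (Φ : Deriv) (f : ℕ → List Bool → ℕ) (g : ℕ → ℕ)
    (hΦ : IsAssocFlow Φ A f g) :
    ∃ (Ψ : Deriv) (f' : ℕ → List Bool → ℕ) (g' : ℕ → ℕ),
      IsAssocFlow Ψ B f' g' ∧ Ψ.prem = Φ.prem ∧ Ψ.concl = Φ.concl := by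
  obtain ⟨Ψ, f', g', h⟩ := (hΦ.realizes.red hred).exists_isAssocFlow
  exact ⟨Ψ, f', g', h⟩

end AF
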